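/- For all but countably many complex numbers z, the equation ζ(1/2 + it) = z has at most one real solution t. -/

import Mathlib

open Complex

theorem phase_shift_contradiction {f : ℝ → ℂ} {θ : ℝ → ℝ} {F : ℝ → ℂ} {I W : Set ℝ} {c : ℝ}
    (hI : IsOpen I) (hIc : IsPreconnected I) (hIn : I.Nontrivial) (hc : c ∈ closure I)
    (hf : DifferentiableAt ℝ f c) (hθ : DifferentiableAt ℝ θ c)
    (hθc : deriv θ c = 0) (hfc : deriv f c ≠ 0)
    (hF : DifferentiableAt ℝ F (θ c)) (hW : W ∈ nhds (θ c))
    (h : ∀ t ∈ I, θ t ∈ W → f t = F (θ t)) : False := by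
  have hconv : Convex ℝ (closure I) := (Real.convex_iff_isPreconnected.2 hIc).closure
  have hint : (interior (closure I)).Nonempty := by
    obtain ⟨x, hx⟩ := hIn.nonempty
    exact ⟨x, mem_interior_iff_mem_nhds.2 (Filter.mem_of_superset (hI.mem_nhds hx) subset_closure)⟩
  have hu : UniqueDiffWithinAt ℝ (closure I) c := uniqueDiffOn_convex hconv hint c hc
  have hu' : UniqueDiffWithinAt ℝ I c := by
    rw [← uniqueDiffWithinAt_closure]; exact hu
  have hcomp : HasDerivAt (fun t => F (θ t)) 0 c := by
    have := hF.hasDerivAt.scomp c hθ.hasDerivAt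
    simpa [hθc, Function.comp_def] using this
  have hev : (fun t => F (θ t)) =ᶠ[nhdsWithin c I] f := by
    have : ∀ᶠ t in nhdsWithin c I, θ t ∈ W :=
      (hθ.continuousAt.eventually hW).filter_mono nhdsWithin_le_nhds
    filter_upwards [this, self_mem_nhdsWithin] with t ht hti
    exact (h t hti ht).symm
  have hmem : Filter.NeBot (nhdsWithin c I) := mem_closure_iff_nhdsWithin_neBot.1 hc
  have hval : F (θ c) = f c := by
    have h1 : Filter.Tendsto (fun t => F (θ t)) (nhdsWithin c I) (nhds (F (θ c))) :=
      hcomp.continuousAt.continuousWithinAt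
    have h2 : Filter.Tendsto f (nhdsWithin c I) (nhds (f c)) :=
      hf.continuousAt.continuousWithinAt
    exact tendsto_nhds_unique h1 (h2.congr' hev.symm)
  have h1 : HasDerivWithinAt f 0 I c :=
    hcomp.hasDerivWithinAt.congr_of_eventuallyEq hev.symm hval.symm
  exact hfc (hu'.eq_deriv I hf.hasDerivAt.hasDerivWithinAt h1)

theorem AnalyticOnNhd.countable_zeros {D : ℝ → ℂ} {U : Set ℝ} (hD : AnalyticOnNhd ℝ D U)
    (hU : IsPreconnected U) (hne : ∃ x ∈ U, D x ≠ 0) : {x ∈ U | D x = 0}.Countable := by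
  obtain ⟨x₀, hx₀, hx₀'⟩ := hne
  refine (Set.Countable.mono ?_ (countable_setOfPred_isolated_right_within (s := {x ∈ U | D x = 0})))
  rintro x ⟨hxU, hx⟩
  have hev : ∀ᶠ z in nhdsWithin x {x}ᶜ, D z ≠ 0 := by
    rcases (hD x hxU).eventually_eq_zero_or_eventually_ne_zero with h | h
    · exact absurd (hD.eqOn_zero_of_preconnected_of_eventuallyEq_zero hU hxU h hx₀) hx₀'
    · exact h
  have hev' : ∀ᶠ z in nhdsWithin x ({x ∈ U | D x = 0} ∩ Set.Ioi x), D z ≠ 0 :=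
    hev.filter_mono (nhdsWithin_mono _ fun y hy => ne_of_gt hy.2)
  refine ⟨⟨hxU, hx⟩, Filter.empty_mem_iff_bot.1 ?_⟩
  filter_upwards [hev', self_mem_nhdsWithin] with z hz hz'
  exact hz hz'.1.2

theorem countable_self_intersections_of_phase {ι : Type*} [Countable ι] {f : ℝ → ℂ} {θ : ℝ → ℝ}
    {I : ι → Set ℝ} {C : Set ℝ} (hfa : ∀ t, AnalyticAt ℝ f t) (hθa : ∀ t, AnalyticAt ℝ θ t)
    (hIo : ∀ i, IsOpen (I i)) (hIc : ∀ i, IsPreconnected (I i)) (hIn : ∀ i, (I i).Nontrivial)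
    (hinj : ∀ i, Set.InjOn θ (I i)) (hder : ∀ i, ∀ t ∈ I i, deriv θ t ≠ 0)
    (hC : C.Countable) (hcover : ∀ t, t ∉ C → ∃ i, t ∈ I i)
    (hend : ∀ i, ∀ e ∈ closure (θ '' I i), e ∉ θ '' I i →
      ∃ c ∈ closure (I i), θ c = e ∧ deriv θ c = 0 ∧ deriv f c ≠ 0)
    (hrigid : ∀ i j (k : ℤ), (∀ x, x ∈ θ '' I i ↔ x + k * Real.pi ∈ θ '' I j) → i = j ∧ k = 0)
    (hphase : ∀ a b, f a = f b → f a ≠ 0 → ∃ k : ℤ, θ b = θ a + k * Real.pi) :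
    {z | ∃ a b, a ≠ b ∧ f a = z ∧ f b = z}.Countable := by
  set A : ι → ℝ → ℝ := fun i => Function.invFunOn θ (I i) with hA
  have hAθ : ∀ i, ∀ t ∈ I i, A i (θ t) = t := fun i t ht =>
    (hinj i).leftInvOn_invFunOn ht
  have hVo : ∀ i, IsOpen (θ '' I i) := by
    intro i
    rw [isOpen_iff_mem_nhds]
    rintro _ ⟨t, ht, rfl⟩
    have hst := (hθa t).hasStrictDerivAt
    rw [← hst.map_nhds_eq (hder i t ht)]
    exact Filter.image_mem_map ((hIo i).mem_nhds ht)
  have hVc : ∀ i, IsPreconnected (θ '' I i) := fun i =>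
    (hIc i).image θ fun t _ => (hθa t).continuousAt.continuousWithinAt
  set F : ι → ℝ → ℂ := fun i => f ∘ A i with hF
  have hFθ : ∀ i, ∀ t ∈ I i, F i (θ t) = f t := fun i t ht => by simp [hF, hAθ i t ht]
  have hFa : ∀ i, ∀ x ∈ θ '' I i, AnalyticAt ℝ (F i) x := by
    rintro i _ ⟨t, ht, rfl⟩
    rw [← analyticAt_comp_iff_of_deriv_ne_zero (hθa t) (hder i t ht)]
    refine (hfa t).congr ?_
    filter_upwards [(hIo i).mem_nhds ht] with u hu
    exact (hFθ i u hu).symm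
  have key : ∀ i j (k : ℤ), ¬ (i = j ∧ k = 0) →
      {z | ∃ a ∈ I i, ∃ b ∈ I j, θ b = θ a + k * Real.pi ∧ f a = z ∧ f b = z}.Countable := by
    intro i j k hijk
    set U : Set ℝ := {x | x ∈ θ '' I i ∧ x + k * Real.pi ∈ θ '' I j} with hU
    have hUc : IsPreconnected U := by
      have h1 := (hVc i).ordConnected
      have h2 := (hVc j).ordConnected
      refine Set.OrdConnected.isPreconnected ⟨fun x hx y hy z hz => ⟨h1.out hx.1 hy.1 hz, ?_⟩⟩
      exact h2.out hx.2 hy.2 ⟨by linarith [hz.1], by linarith [hz.2]⟩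
    set D : ℝ → ℂ := fun x => F i x - F j (x + k * Real.pi) with hD
    have hDa : AnalyticOnNhd ℝ D U := by
      intro x hx
      refine (hFa i x hx.1).sub ?_
      exact AnalyticAt.comp (f := fun x : ℝ => x + k * Real.pi) (hFa j _ hx.2)
        (analyticAt_id.add analyticAt_const)
    by_cases hne : ∃ x ∈ U, D x ≠ 0
    · refine ((hDa.countable_zeros hUc hne).image (F i)).mono ?_
      rintro z ⟨a, ha, b, hb, hab, rfl, hz⟩
      refine ⟨θ a, ⟨⟨⟨a, ha, rfl⟩, ⟨b, hb, hab⟩⟩, ?_⟩, hFθ i a ha⟩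
      simp only [hD]
      rw [← hab, hFθ i a ha, hFθ j b hb, hz, sub_self]
    · push Not at hne
      rcases U.eq_empty_or_nonempty with hemp | hUn
      · convert Set.countable_empty
        rw [Set.eq_empty_iff_forall_notMem]
        rintro z ⟨a, ha, b, hb, hab, -⟩
        exact (hemp ▸ (⟨⟨a, ha, rfl⟩, ⟨b, hb, hab⟩⟩ : θ a ∈ U) : θ a ∈ (∅ : Set ℝ))
      · exfalso
        have hcont : Continuous fun x : ℝ => x + k * Real.pi := by fun_prop
        have c1 : ∀ e ∈ closure U, e + k * Real.pi ∈ θ '' I j → e ∈ θ '' I i := by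
          intro e he hej
          by_contra hei
          obtain ⟨c, hc, rfl, hc1, hc2⟩ := hend i e (closure_mono (fun x hx => hx.1) he) hei
          refine phase_shift_contradiction (F := fun x => F j (x + k * Real.pi))
            (W := {x | x + k * Real.pi ∈ θ '' I j}) (hIo i) (hIc i) (hIn i) hc
            (hfa c).differentiableAt (hθa c).differentiableAt hc1 hc2 ?_ ?_ ?_
          · exact DifferentiableAt.comp (𝕜 := ℝ) (g := F j) (f := fun x : ℝ => x + k * Real.pi) _
              (hFa j _ hej).differentiableAt (by fun_prop)
          · exact ((hVo j).preimage hcont).mem_nhds hej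
          · intro t ht htW
            have := hne (θ t) ⟨⟨t, ht, rfl⟩, htW⟩
            simp only [hD, hFθ i t ht] at this
            exact sub_eq_zero.1 this
        have c2 : ∀ e ∈ closure U, e ∈ θ '' I i → e + k * Real.pi ∈ θ '' I j := by
          intro e he hei
          by_contra hej
          have he' : e + k * Real.pi ∈ closure (θ '' I j) :=
            map_mem_closure (f := fun x : ℝ => x + k * Real.pi) hcont he fun x (hx : x ∈ U) => hx.2
          obtain ⟨c, hc, hce, hc1, hc2⟩ := hend j _ he' hej
          have hee : θ c - k * Real.pi = e := by rw [hce]; ring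
          refine phase_shift_contradiction (F := fun x => F i (x - k * Real.pi))
            (W := {x | x - k * Real.pi ∈ θ '' I i}) (hIo j) (hIc j) (hIn j) hc
            (hfa c).differentiableAt (hθa c).differentiableAt hc1 hc2 ?_ ?_ ?_
          · refine DifferentiableAt.comp (𝕜 := ℝ) (g := F i)
              (f := fun x : ℝ => x - k * Real.pi) _ ?_ (by fun_prop)
            rw [hee]
            exact (hFa i _ hei).differentiableAt
          · refine ((hVo i).preimage (by fun_prop : Continuous fun x : ℝ => x - k * Real.pi)).mem_nhds
              ?_
            rw [Set.mem_preimage, hee]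
            exact hei
          · intro t ht htW
            have := hne (θ t - k * Real.pi) ⟨htW, t, ht, by ring⟩
            simp only [hD, sub_add_cancel, hFθ j t ht] at this
            exact (sub_eq_zero.1 this).symm
        have hUo : IsOpen U := (hVo i).inter ((hVo j).preimage hcont)
        have clopen : ∀ {V : Set ℝ}, IsPreconnected V → U ⊆ V →
            (∀ e ∈ closure U, e ∈ V → e ∈ U) → V ⊆ U := by
          intro V hV hUV hcl
          refine fun x hx => of_not_not fun hxU => ?_
          obtain ⟨y, hy⟩ := hUn
          obtain ⟨w, hwV, hw1, hw2⟩ := hV U (closure U)ᶜ hUo isClosed_closure.isOpen_compl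
            (fun w hw => or_iff_not_imp_right.2 fun h => hcl w (not_not.1 h) hw)
            ⟨y, hUV hy, hy⟩ ⟨x, hx, fun h => hxU (hcl x h hx)⟩
          exact hw2 (subset_closure hw1)
        have d1 : θ '' I i ⊆ U := clopen (hVc i) (fun x hx => hx.1)
          fun e he hei => ⟨hei, c2 e he hei⟩
        have d2 : {x | x + k * Real.pi ∈ θ '' I j} ⊆ U := by
          refine clopen ?_ (fun x hx => hx.2)
            fun e he hej => ⟨c1 e he hej, hej⟩
          have h2 := (hVc j).ordConnected
          refine Set.OrdConnected.isPreconnected ⟨fun x hx y hy z hz => ?_⟩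
          exact h2.out hx hy ⟨by linarith [hz.1], by linarith [hz.2]⟩
        exact hijk (hrigid i j k fun x => ⟨fun hx => (d1 hx).2, fun hx => (d2 hx).1⟩)
  have hbig : ({0} ∪ f '' C ∪ ⋃ (i : ι) (j : ι) (k : ℤ) (_ : ¬ (i = j ∧ k = 0)),
      {z | ∃ a ∈ I i, ∃ b ∈ I j, θ b = θ a + k * Real.pi ∧ f a = z ∧ f b = z}).Countable := by
    refine ((Set.countable_singleton _).union (hC.image f)).union ?_
    refine Set.countable_iUnion fun i => Set.countable_iUnion fun j => Set.countable_iUnion fun k =>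
      Set.countable_iUnion fun h => key i j k h
  refine hbig.mono ?_
  rintro z ⟨a, b, hab, rfl, hb⟩
  by_cases h0 : f a = 0
  · exact Or.inl (Or.inl h0)
  by_cases haC : a ∈ C
  · exact Or.inl (Or.inr ⟨a, haC, rfl⟩)
  by_cases hbC : b ∈ C
  · exact Or.inl (Or.inr ⟨b, hbC, hb⟩)
  obtain ⟨i, hi⟩ := hcover a haC
  obtain ⟨j, hj⟩ := hcover b hbC
  obtain ⟨k, hk⟩ := hphase a b hb.symm h0
  refine Or.inr ?_
  simp only [Set.mem_iUnion]
  refine ⟨i, j, k, ?_, a, hi, b, hj, hk, rfl, hb⟩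
  rintro ⟨rfl, rfl⟩
  exact hab (hinj i hi hj (by simpa using hk.symm))

/-- The seventh Bernoulli polynomial on the unit interval. -/
theorem abs_bernoulli_seven_le {u : ℝ} (h0 : 0 ≤ u) (h1 : u ≤ 1) :
    |u ^ 7 - 7 / 2 * u ^ 6 + 7 / 2 * u ^ 5 - 7 / 6 * u ^ 3 + 1 / 6 * u| ≤ 0.0312 := by
  set v := u - 1 / 2 with hv
  set q := u ^ 2 - u with hq
  have e : u ^ 7 - 7 / 2 * u ^ 6 + 7 / 2 * u ^ 5 - 7 / 6 * u ^ 3 + 1 / 6 * u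
      = (v * q) * ((3 * q ^ 2 - 3 * q + 1) / 3) := by
    rw [hv, hq]; ring
  have hq0 : q ≤ 0 := by nlinarith
  have hq1 : -(1 / 4) ≤ q := by nlinarith [sq_nonneg (u - 1 / 2)]
  have h2 : |v * q| ≤ 0.0482 := by
    refine abs_le_of_sq_le_sq ?_ (by norm_num)
    have : (v * q) ^ 2 = (q + 1 / 4) * q ^ 2 := by rw [hv, hq]; ring
    rw [this]
    nlinarith [mul_nonneg (by linarith : 0 ≤ 1 / 12 - q) (sq_nonneg (q + 1 / 6))]
  have h3 : |(3 * q ^ 2 - 3 * q + 1) / 3| ≤ 31 / 48 := by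
    rw [abs_le]
    constructor <;> nlinarith
  rw [e, abs_mul]
  calc _ ≤ 0.0482 * (31 / 48) := mul_le_mul h2 h3 (abs_nonneg _) (by norm_num)
    _ ≤ 0.0312 := by norm_num

/-- The Euler–Maclaurin correction term for `∑ n ^ (-s)`, with the Bernoulli numbers up to `B₆`. -/
noncomputable def zetaTail (s : ℂ) (x : ℝ) : ℂ :=
  (x : ℂ) ^ (1 - s) / (s - 1) + (x : ℂ) ^ (-s) / 2 + s * (x : ℂ) ^ (-s - 1) / 12
    - s * (s + 1) * (s + 2) * (x : ℂ) ^ (-s - 3) / 720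
    + s * (s + 1) * (s + 2) * (s + 3) * (s + 4) * (x : ℂ) ^ (-s - 5) / 30240

/-- The rising factorial `s (s + 1) ⋯ (s + 6)`. -/
def rising (s : ℂ) : ℂ := s * (s + 1) * (s + 2) * (s + 3) * (s + 4) * (s + 5) * (s + 6)

theorem hasDerivAt_shift_cpow (a : ℂ) {n u : ℝ} (h : 0 < n + u) :
    HasDerivAt (fun u : ℝ => ((n + u : ℝ) : ℂ) ^ a) (a * ((n + u : ℝ) : ℂ) ^ (a - 1)) u := by
  have h1 : HasDerivAt (fun z : ℂ => (n : ℂ) + z) 1 u := (hasDerivAt_id _).const_add _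
  have h2 := (h1.cpow_const (c := a) (by
    rw [← ofReal_add]; exact Complex.ofReal_mem_slitPlane.2 h)).comp_ofReal
  simpa using h2

theorem norm_zetaTail_step_le {s : ℂ} (hs : -(1 / 2) ≤ s.re) (hs1 : s ≠ 1) {n : ℝ} (hn : 1 ≤ n) :
    ‖(n : ℂ) ^ (-s) - zetaTail s n + zetaTail s (n + 1)‖ ≤
      0.0312 / 5040 * ‖rising s‖ *
        ((n ^ (-(11 / 2) : ℝ) - (n + 1) ^ (-(11 / 2) : ℝ)) / (11 / 2)) := by
  set p : ℂ → ℝ → ℂ := fun a u => ((n + u : ℝ) : ℂ) ^ a with hp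
  have hpd : ∀ a : ℂ, ∀ u : ℝ, 0 ≤ u → HasDerivAt (p a) (a * p (a - 1) u) u :=
    fun a u hu => hasDerivAt_shift_cpow a (by linarith)
  set W : ℝ → ℂ := fun u => p (1 - s) u / (1 - s)
    - ((u : ℂ) - 1 / 2) * p (-s) u
    - ((u : ℂ) ^ 2 - u + 1 / 6) / 2 * s * p (-s - 1) u
    - ((u : ℂ) ^ 3 - 3 / 2 * u ^ 2 + 1 / 2 * u) / 6 * (s * (s + 1)) * p (-s - 2) u
    - ((u : ℂ) ^ 4 - 2 * u ^ 3 + u ^ 2 - 1 / 30) / 24 * (s * (s + 1) * (s + 2)) * p (-s - 3) u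
    - ((u : ℂ) ^ 5 - 5 / 2 * u ^ 4 + 5 / 3 * u ^ 3 - 1 / 6 * u) / 120
        * (s * (s + 1) * (s + 2) * (s + 3)) * p (-s - 4) u
    - ((u : ℂ) ^ 6 - 3 * u ^ 5 + 5 / 2 * u ^ 4 - 1 / 2 * u ^ 2 + 1 / 42) / 720
        * (s * (s + 1) * (s + 2) * (s + 3) * (s + 4)) * p (-s - 5) u
    - ((u : ℂ) ^ 7 - 7 / 2 * u ^ 6 + 7 / 2 * u ^ 5 - 7 / 6 * u ^ 3 + 1 / 6 * u) / 5040
        * (s * (s + 1) * (s + 2) * (s + 3) * (s + 4) * (s + 5)) * p (-s - 6) u with hW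
  have hs1' : 1 - s ≠ 0 := sub_ne_zero.2 hs1.symm
  have hWd : ∀ u : ℝ, 0 ≤ u → HasDerivAt W
      (((u : ℂ) ^ 7 - 7 / 2 * u ^ 6 + 7 / 2 * u ^ 5 - 7 / 6 * u ^ 3 + 1 / 6 * u) / 5040
        * rising s * p (-s - 7) u) u := by
    intro u hu
    have hid : HasDerivAt (fun u : ℝ => (u : ℂ)) 1 u := by
      simpa using (hasDerivAt_id u).ofReal_comp
    have hB : ∀ m : ℕ, HasDerivAt (fun u : ℝ => (u : ℂ) ^ m) (m * (u : ℂ) ^ (m - 1)) u := by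
      exact fun m => (hasDerivAt_pow m (u : ℂ)).comp_ofReal
    have d0 := (hpd (1 - s) u hu).div_const (1 - s)
    have d1 := (hid.sub_const (1 / 2)).mul (hpd (-s) u hu)
    have d2 := (((((hB 2).sub hid).add_const (1 / 6)).div_const 2).mul_const s).mul
      (hpd (-s - 1) u hu)
    have d3 := (((((hB 3).sub ((hB 2).const_mul (3 / 2))).add (hid.const_mul (1 / 2))).div_const
      6).mul_const (s * (s + 1))).mul (hpd (-s - 2) u hu)
    have d4 := ((((((hB 4).sub ((hB 3).const_mul 2)).add (hB 2)).sub_const (1 / 30)).div_const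
      24).mul_const (s * (s + 1) * (s + 2))).mul (hpd (-s - 3) u hu)
    have d5 := ((((((hB 5).sub ((hB 4).const_mul (5 / 2))).add ((hB 3).const_mul (5 / 3))).sub
      (hid.const_mul (1 / 6))).div_const 120).mul_const (s * (s + 1) * (s + 2) * (s + 3))).mul
      (hpd (-s - 4) u hu)
    have d6 := (((((((hB 6).sub ((hB 5).const_mul 3)).add ((hB 4).const_mul (5 / 2))).sub
      ((hB 2).const_mul (1 / 2))).add_const (1 / 42)).div_const 720).mul_const
      (s * (s + 1) * (s + 2) * (s + 3) * (s + 4))).mul (hpd (-s - 5) u hu)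
    have d7 := (((((((hB 7).sub ((hB 6).const_mul (7 / 2))).add ((hB 5).const_mul (7 / 2))).sub
      ((hB 3).const_mul (7 / 6))).add (hid.const_mul (1 / 6))).div_const 5040).mul_const
      (s * (s + 1) * (s + 2) * (s + 3) * (s + 4) * (s + 5))).mul (hpd (-s - 6) u hu)
    have := ((((((d0.sub d1).sub d2).sub d3).sub d4).sub d5).sub d6).sub d7
    refine this.congr_deriv ?_
    have e0 : (1 - s) * p (1 - s - 1) u / (1 - s) = p (-s) u := by
      rw [show 1 - s - 1 = -s by ring]; field_simp
    rw [e0, show -s - 1 - 1 = -s - 2 by ring, show -s - 2 - 1 = -s - 3 by ring,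
      show -s - 3 - 1 = -s - 4 by ring, show -s - 4 - 1 = -s - 5 by ring,
      show -s - 5 - 1 = -s - 6 by ring, show -s - 6 - 1 = -s - 7 by ring]
    simp only [rising, Pi.sub_apply, Pi.add_apply]
    push_cast
    ring
  have hend : W 1 - W 0 = -((n : ℂ) ^ (-s) - zetaTail s n + zetaTail s (n + 1)) := by
    have h1 : (s - 1) = -(1 - s) := by ring
    simp only [hW, hp, zetaTail, h1, div_neg]
    push_cast
    simp only [add_zero]
    ring
  set C := 0.0312 / 5040 * ‖rising s‖ with hC
  have hC0 : 0 ≤ C := by positivity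
  have hBd : ∀ u : ℝ, 0 ≤ u → HasDerivAt
      (fun u => C * ((n ^ (-(11 / 2) : ℝ) - (n + u) ^ (-(11 / 2) : ℝ)) / (11 / 2)))
      (C * (n + u) ^ (-(13 / 2) : ℝ)) u := by
    intro u hu
    have h := ((hasDerivAt_id u).const_add n).rpow_const (p := (-(11 / 2) : ℝ))
      (Or.inl (by simp only [id]; linarith))
    have h' := ((h.const_sub (n ^ (-(11 / 2) : ℝ))).div_const (11 / 2)).const_mul C
    refine h'.congr_deriv ?_
    rw [show (-(11 / 2) - 1 : ℝ) = -(13 / 2) by norm_num]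
    simp only [id]
    ring
  have hle : ∀ u ∈ Set.Ico (0 : ℝ) 1,
      ‖((u : ℂ) ^ 7 - 7 / 2 * u ^ 6 + 7 / 2 * u ^ 5 - 7 / 6 * u ^ 3 + 1 / 6 * u) / 5040
        * rising s * p (-s - 7) u‖ ≤ C * (n + u) ^ (-(13 / 2) : ℝ) := by
    intro u hu
    have hx : 0 < n + u := by linarith [hu.1]
    have h1 : ‖((u : ℂ) ^ 7 - 7 / 2 * u ^ 6 + 7 / 2 * u ^ 5 - 7 / 6 * u ^ 3 + 1 / 6 * u)‖
        ≤ 0.0312 := by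
      have := abs_bernoulli_seven_le hu.1 hu.2.le
      rw [← Real.norm_eq_abs, ← Complex.norm_real] at this
      push_cast at this
      exact this
    have h2 : ‖p (-s - 7) u‖ ≤ (n + u) ^ (-(13 / 2) : ℝ) := by
      simp only [hp]
      rw [Complex.norm_cpow_eq_rpow_re_of_pos hx]
      refine Real.rpow_le_rpow_of_exponent_le (by linarith [hu.1]) ?_
      simp only [sub_re, neg_re, re_ofNat]
      linarith
    rw [norm_mul, norm_mul, norm_div, hC]
    refine mul_le_mul (mul_le_mul_of_nonneg_right ?_ (norm_nonneg _)) h2 (norm_nonneg _)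
      (by positivity)
    rw [show ‖(5040 : ℂ)‖ = 5040 by simp]
    gcongr
  have hbd := image_norm_le_of_norm_deriv_right_le_deriv_boundary' (a := 0) (b := 1)
    (f := fun u => W u - W 0)
    (f' := fun u => ((u : ℂ) ^ 7 - 7 / 2 * u ^ 6 + 7 / 2 * u ^ 5 - 7 / 6 * u ^ 3 + 1 / 6 * u) / 5040
        * rising s * p (-s - 7) u)
    (B := fun u => C * ((n ^ (-(11 / 2) : ℝ) - (n + u) ^ (-(11 / 2) : ℝ)) / (11 / 2)))
    (B' := fun u => C * (n + u) ^ (-(13 / 2) : ℝ))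
    (fun u hu => ((hWd u hu.1).sub_const _).continuousAt.continuousWithinAt)
    (fun u hu => ((hWd u hu.1).sub_const _).hasDerivWithinAt) (by simp)
    (fun u hu => (hBd u hu.1).continuousAt.continuousWithinAt)
    (fun u hu => (hBd u hu.1).hasDerivWithinAt) hle (Set.right_mem_Icc.2 zero_le_one)
  simp only [hend, norm_neg] at hbd
  exact hbd

/-- The general term of the series expressing the remainder in the Euler–Maclaurin formula. -/
noncomputable def zetaStep (s : ℂ) (k : ℕ) : ℂ :=
  (((k : ℝ) + 2 : ℝ) : ℂ) ^ (-s) - zetaTail s (k + 2) + zetaTail s (k + 2 + 1)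

/-- The remainder in the Euler–Maclaurin formula for `ζ`. -/
noncomputable def zetaRem (s : ℂ) : ℂ := ∑' k, zetaStep s k

theorem hasSum_rpow_telescope :
    HasSum (fun k : ℕ => (((k : ℝ) + 2) ^ (-(11 / 2) : ℝ) - ((k : ℝ) + 2 + 1) ^ (-(11 / 2) : ℝ))
      / (11 / 2)) ((2 : ℝ) ^ (-(11 / 2) : ℝ) / (11 / 2)) := by
  refine HasSum.div_const ?_ _
  rw [hasSum_iff_tendsto_nat_of_nonneg]
  · have h : ∀ n : ℕ, ∑ k ∈ Finset.range n,
        (((k : ℝ) + 2) ^ (-(11 / 2) : ℝ) - ((k : ℝ) + 2 + 1) ^ (-(11 / 2) : ℝ))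
        = (2 : ℝ) ^ (-(11 / 2) : ℝ) - ((n : ℝ) + 2) ^ (-(11 / 2) : ℝ) := by
      intro n
      induction n with
      | zero => simp
      | succ n ih =>
        rw [Finset.sum_range_succ, ih]
        push_cast
        rw [show (n : ℝ) + 2 + 1 = n + 1 + 2 by ring]
        ring
    simp only [h]
    have h0 : Filter.Tendsto (fun n : ℕ => ((n : ℝ) + 2) ^ (-(11 / 2) : ℝ)) Filter.atTop
        (nhds 0) :=
      (tendsto_rpow_neg_atTop (by norm_num)).comp
        (Filter.tendsto_atTop_add_const_right _ _ tendsto_natCast_atTop_atTop)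
    simpa using h0.const_sub ((2 : ℝ) ^ (-(11 / 2) : ℝ))
  · intro k
    refine sub_nonneg.2 (Real.rpow_le_rpow_of_nonpos (by positivity) (by linarith) (by norm_num))

theorem norm_zetaStep_le {s : ℂ} (hs : -(1 / 2) ≤ s.re) (hs1 : s ≠ 1) (k : ℕ) :
    ‖zetaStep s k‖ ≤ 0.0312 / 5040 * ‖rising s‖ *
      ((((k : ℝ) + 2) ^ (-(11 / 2) : ℝ) - ((k : ℝ) + 2 + 1) ^ (-(11 / 2) : ℝ)) / (11 / 2)) :=
  norm_zetaTail_step_le hs hs1 (by have : (0 : ℝ) ≤ k := k.cast_nonneg; linarith)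

theorem summable_zetaStep {s : ℂ} (hs : -(1 / 2) ≤ s.re) (hs1 : s ≠ 1) :
    Summable (zetaStep s) :=
  Summable.of_norm_bounded (hasSum_rpow_telescope.summable.mul_left _) (norm_zetaStep_le hs hs1)

theorem norm_zetaRem_le {s : ℂ} (hs : -(1 / 2) ≤ s.re) (hs1 : s ≠ 1) :
    ‖zetaRem s‖ ≤ 0.0312 / 5040 * ‖rising s‖ * ((2 : ℝ) ^ (-(11 / 2) : ℝ) / (11 / 2)) :=
  tsum_of_norm_bounded (hasSum_rpow_telescope.mul_left _) (norm_zetaStep_le hs hs1)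

theorem tendsto_zetaTail {s : ℂ} (hs : 1 < s.re) :
    Filter.Tendsto (fun n : ℕ => zetaTail s ((n : ℝ) + 2)) Filter.atTop (nhds 0) := by
  have key : ∀ a : ℂ, a.re < 0 → Filter.Tendsto (fun n : ℕ => (((n : ℝ) + 2 : ℝ) : ℂ) ^ a)
      Filter.atTop (nhds 0) := by
    intro a ha
    rw [tendsto_zero_iff_norm_tendsto_zero]
    have h0 : Filter.Tendsto (fun n : ℕ => ((n : ℝ) + 2) ^ (a.re)) Filter.atTop (nhds 0) := by
      have := (tendsto_rpow_neg_atTop (neg_pos.2 ha)).comp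
        (Filter.tendsto_atTop_add_const_right _ (2 : ℝ) (tendsto_natCast_atTop_atTop (R := ℝ)))
      simpa [Function.comp_def] using this
    refine h0.congr fun n => ?_
    rw [Complex.norm_cpow_eq_rpow_re_of_pos (by positivity)]
  have := (((((key (1 - s) (by simp; linarith)).div_const (s - 1)).add
    ((key (-s) (by simp; linarith)).div_const 2)).add
    (((key (-s - 1) (by simp; linarith)).const_mul s).div_const 12)).sub
    (((key (-s - 3) (by simp; linarith)).const_mul (s * (s + 1) * (s + 2))).div_const 720)).add
    (((key (-s - 5) (by simp; linarith)).const_mul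
      (s * (s + 1) * (s + 2) * (s + 3) * (s + 4))).div_const 30240)
  simpa [zetaTail] using this

theorem riemannZeta_eq_of_one_lt_re {s : ℂ} (hs : 1 < s.re) :
    riemannZeta s = 1 + zetaTail s 2 + zetaRem s := by
  have hs1 : s ≠ 1 := by rintro rfl; simp at hs
  have h1 := (summable_zetaStep (by linarith) hs1).hasSum.tendsto_sum_nat
  have hz : HasSum (fun n : ℕ => 1 / ((n : ℂ)) ^ s) (riemannZeta s) := by
    rw [zeta_eq_tsum_one_div_nat_cpow hs]
    exact (Complex.summable_one_div_nat_cpow.2 hs).hasSum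
  have hs0 : s ≠ 0 := by rintro rfl; simp at hs; linarith
  have h2 : Filter.Tendsto (fun n : ℕ => ∑ k ∈ Finset.range (n + 2), 1 / ((k : ℂ)) ^ s)
      Filter.atTop (nhds (riemannZeta s)) :=
    hz.tendsto_sum_nat.comp (Filter.tendsto_add_atTop_nat 2)
  have h : ∀ n : ℕ, ∑ k ∈ Finset.range n, zetaStep s k
      = (∑ k ∈ Finset.range (n + 2), 1 / ((k : ℂ)) ^ s) - 1 - zetaTail s 2
        + zetaTail s ((n : ℝ) + 2) := by
    intro n
    induction n with
    | zero => simp [Finset.sum_range_succ, hs0]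
    | succ n ih =>
      rw [Finset.sum_range_succ, ih, Finset.sum_range_succ _ (n + 2), zetaStep]
      push_cast
      rw [show (n : ℝ) + 2 + 1 = n + 1 + 2 by ring, cpow_neg]
      ring
  have h3 := ((h2.sub_const 1).sub_const (zetaTail s 2)).add (tendsto_zetaTail hs)
  have := tendsto_nhds_unique h1 (h3.congr fun n => (h n).symm)
  rw [zetaRem, this]
  ring

theorem differentiableAt_zetaTail {s : ℂ} (hs1 : s ≠ 1) {x : ℝ} (hx : 0 < x) :
    DifferentiableAt ℂ (fun s => zetaTail s x) s := by
  have hx' : (x : ℂ) ≠ 0 := by exact_mod_cast hx.ne'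
  have hs1' : s - 1 ≠ 0 := sub_ne_zero.2 hs1
  have key : ∀ a : ℂ → ℂ, DifferentiableAt ℂ a s → DifferentiableAt ℂ (fun s => (x : ℂ) ^ a s) s :=
    fun a ha => ha.const_cpow (Or.inl hx')
  have k1 := key (fun s => 1 - s) (by fun_prop)
  have k2 := key (fun s => -s) (by fun_prop)
  have k3 := key (fun s => -s - 1) (by fun_prop)
  have k4 := key (fun s => -s - 3) (by fun_prop)
  have k5 := key (fun s => -s - 5) (by fun_prop)
  unfold zetaTail
  fun_prop (disch := assumption)

/-- A bounded convex region in which the Euler–Maclaurin formula is used. -/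
def emRegion : Set ℂ := {s | 0 < s.im} ∩ {s | -(1 / 2) < s.re} ∩ Metric.ball 0 20

theorem isOpen_emRegion : IsOpen emRegion :=
  ((isOpen_lt continuous_const Complex.continuous_im).inter
    (isOpen_lt continuous_const Complex.continuous_re)).inter Metric.isOpen_ball

theorem convex_emRegion : Convex ℝ emRegion :=
  ((convex_halfSpace_im_gt 0).inter (convex_halfSpace_re_gt _)).inter (convex_ball _ _)

theorem ne_one_of_mem_emRegion {s : ℂ} (h : s ∈ emRegion) : s ≠ 1 := by
  rintro rfl
  simpa using h.1.1

theorem norm_rising_le {s : ℂ} (h : ‖s‖ ≤ 20) : ‖rising s‖ ≤ 26 ^ 7 := by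
  have key : ∀ a : ℂ, ‖a‖ ≤ 6 → ‖s + a‖ ≤ 26 := fun a ha =>
    (norm_add_le _ _).trans (by linarith)
  unfold rising
  simp only [norm_mul]
  have h0 : ‖s‖ ≤ 26 := by linarith
  have h1 := key 1 (by norm_num)
  have h2 := key 2 (by norm_num)
  have h3 := key 3 (by norm_num)
  have h4 := key 4 (by norm_num)
  have h5 := key 5 (by norm_num)
  have h6 := key 6 (by norm_num)
  calc _ ≤ (26 : ℝ) * 26 * 26 * 26 * 26 * 26 * 26 := by gcongr
    _ = 26 ^ 7 := by norm_num

theorem differentiableOn_zetaRem : DifferentiableOn ℂ zetaRem emRegion := by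
  refine Complex.differentiableOn_tsum_of_summable_norm
    (hasSum_rpow_telescope.summable.mul_left (0.0312 / 5040 * 26 ^ 7)) ?_ isOpen_emRegion ?_
  · intro k s hs
    have hs1 := ne_one_of_mem_emRegion hs
    have hk : (0 : ℝ) < (k : ℝ) + 2 := by positivity
    have hk' : (((k : ℝ) + 2 : ℝ) : ℂ) ≠ 0 := by exact_mod_cast hk.ne'
    exact ((((differentiableAt_id.neg).const_cpow (Or.inl hk')).sub
      (differentiableAt_zetaTail hs1 hk)).add
      (differentiableAt_zetaTail hs1 (by positivity))).differentiableWithinAt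
  · intro k s hs
    refine (norm_zetaStep_le hs.1.2.le (ne_one_of_mem_emRegion hs) k).trans ?_
    have hr := norm_rising_le (mem_ball_zero_iff.1 hs.2).le
    refine mul_le_mul_of_nonneg_right (mul_le_mul_of_nonneg_left hr (by norm_num)) ?_
    refine div_nonneg (sub_nonneg.2 ?_) (by norm_num)
    exact Real.rpow_le_rpow_of_nonpos (by positivity) (by linarith) (by norm_num)

theorem riemannZeta_eqOn_emRegion :
    Set.EqOn riemannZeta (fun s => 1 + zetaTail s 2 + zetaRem s) emRegion := by
  have hz : AnalyticOnNhd ℂ riemannZeta emRegion :=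
    DifferentiableOn.analyticOnNhd (fun s hs => (differentiableAt_riemannZeta
      (ne_one_of_mem_emRegion hs)).differentiableWithinAt) isOpen_emRegion
  have hr : AnalyticOnNhd ℂ (fun s => 1 + zetaTail s 2 + zetaRem s) emRegion := by
    refine DifferentiableOn.analyticOnNhd (DifferentiableOn.add (fun s hs => ?_)
      differentiableOn_zetaRem) isOpen_emRegion
    exact ((differentiableAt_zetaTail (ne_one_of_mem_emRegion hs)
      two_pos).const_add 1).differentiableWithinAt
  refine hz.eqOn_of_preconnected_of_eventuallyEq hr convex_emRegion.isPreconnected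
    (z₀ := 2 + I) ⟨⟨by simp, by simp; norm_num⟩, ?_⟩ ?_
  · rw [mem_ball_zero_iff]
    refine (norm_add_le _ _).trans_lt ?_
    simp; norm_num
  · have : ∀ᶠ s : ℂ in nhds (2 + I), 1 < s.re :=
      (isOpen_lt continuous_const Complex.continuous_re).mem_nhds (by simp)
    filter_upwards [this] with s hs
    exact riemannZeta_eq_of_one_lt_re hs

/-- `2 ^ s * zetaTail s 2`, a rational function. -/
noncomputable def tailPoly (s : ℂ) : ℂ :=
  2 / (s - 1) + 1 / 2 + s / 24 - (s ^ 3 + 3 * s ^ 2 + 2 * s) / 5760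
    + (s ^ 5 + 10 * s ^ 4 + 35 * s ^ 3 + 50 * s ^ 2 + 24 * s) / 967680

/-- The derivative of `tailPoly`. -/
noncomputable def tailPolyDeriv (s : ℂ) : ℂ :=
  -2 / (s - 1) ^ 2 + 1 / 24 - (3 * s ^ 2 + 6 * s + 2) / 5760
    + (5 * s ^ 4 + 40 * s ^ 3 + 105 * s ^ 2 + 100 * s + 24) / 967680

theorem hasDerivAt_tailPoly {s : ℂ} (hs : s ≠ 1) :
    HasDerivAt tailPoly (tailPolyDeriv s) s := by
  have hs' : s - 1 ≠ 0 := sub_ne_zero.2 hs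
  have hid := hasDerivAt_id' s
  have hB : ∀ m : ℕ, HasDerivAt (fun z : ℂ => z ^ m) (m * s ^ (m - 1)) s := fun m =>
    hasDerivAt_pow m s
  have h := (((((hasDerivAt_const s (2 : ℂ)).div (hid.sub_const 1) hs').add_const (1 / 2)).add
    (hid.div_const 24)).sub ((((hB 3).add ((hB 2).const_mul 3)).add
    (hid.const_mul 2)).div_const 5760)).add (((((((hB 5).add ((hB 4).const_mul 10)).add
    ((hB 3).const_mul 35))).add ((hB 2).const_mul 50)).add (hid.const_mul 24)).div_const 967680)
  refine h.congr_deriv ?_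
  unfold tailPolyDeriv
  push_cast
  ring

theorem zetaTail_two (s : ℂ) : zetaTail s 2 = (2 : ℂ) ^ (-s) * tailPoly s := by
  have h2 : (2 : ℂ) ≠ 0 := two_ne_zero
  have e1 : (2 : ℂ) ^ (1 - s) = 2 ^ (-s) * 2 := by
    rw [show 1 - s = -s + 1 by ring, cpow_add _ _ h2, cpow_one]
  have e3 : ∀ m : ℕ, (2 : ℂ) ^ (-s - m) = 2 ^ (-s) / 2 ^ m := by
    intro m; rw [cpow_sub _ _ h2, cpow_natCast]
  have f1 := e3 1
  have f3 := e3 3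
  have f5 := e3 5
  push_cast at f1 f3 f5
  unfold zetaTail tailPoly
  rw [ofReal_ofNat, e1, f1, f3, f5]
  ring

theorem hasDerivAt_zetaTail_two {s : ℂ} (hs : s ≠ 1) :
    HasDerivAt (fun s => zetaTail s 2)
      ((2 : ℂ) ^ (-s) * (tailPolyDeriv s - Real.log 2 * tailPoly s)) s := by
  simp only [zetaTail_two]
  have h1 : HasDerivAt (fun s : ℂ => (2 : ℂ) ^ (-s)) _ s :=
    (hasDerivAt_neg s).const_cpow (Or.inl two_ne_zero)
  refine (h1.mul (hasDerivAt_tailPoly hs)).congr_deriv ?_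
  rw [show (Real.log 2 : ℂ) = Complex.log 2 by rw [← ofReal_ofNat, ofReal_log (by norm_num)]]
  ring

theorem re_tailPoly (t : ℝ) : (tailPoly (1 / 2 + t * I)).re =
    -1 / (1 / 4 + t ^ 2) + 25 / 48 - (15 / 8 - 9 / 2 * t ^ 2) / 5760
      + (25 / 2 * t ^ 4 - 475 / 4 * t ^ 2 + 945 / 32) / 967680 := by
  have hI : (I : ℂ) ^ 2 = -1 := I_sq
  have hd : (1 / 4 + t ^ 2 : ℝ) ≠ 0 := by positivity
  have hd' : (1 / 4 + (t : ℂ) ^ 2) ≠ 0 := by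
    have := ofReal_ne_zero.2 hd
    push_cast at this
    exact this
  have hs : (1 / 2 + t * I - 1 : ℂ) ≠ 0 := by
    intro h; have := congrArg re h; norm_num at this
  have e : tailPoly (1 / 2 + t * I) =
      ((-1 / (1 / 4 + t ^ 2) + 25 / 48 - (15 / 8 - 9 / 2 * t ^ 2) / 5760
      + (25 / 2 * t ^ 4 - 475 / 4 * t ^ 2 + 945 / 32) / 967680 : ℝ) : ℂ) +
      ((-2 * t / (1 / 4 + t ^ 2) + t / 24 - ((3 / 4 + 3 + 2) * t - t ^ 3) / 5760
      + (t ^ 5 - (5 / 2 + 20 + 35) * t ^ 3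
        + (5 / 16 + 5 + 105 / 4 + 50 + 24) * t) / 967680 : ℝ) : ℂ) * I := by
    have h1 : 2 / (1 / 2 + t * I - 1 : ℂ) = (-1 - 2 * t * I) / (1 / 4 + (t : ℂ) ^ 2) := by
      rw [div_eq_div_iff hs hd']
      linear_combination (2 * t ^ 2) * hI
    unfold tailPoly
    rw [h1]
    have h2 : (I : ℂ) ^ 3 = -I := by rw [pow_succ, hI]; ring
    have h4 : (I : ℂ) ^ 4 = 1 := I_pow_four
    have h5 : (I : ℂ) ^ 5 = I := by rw [pow_succ, h4]; ring
    push_cast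
    field_simp
    ring_nf
    simp only [hI, h2, h4, h5]
    ring
  rw [e, add_re, ofReal_re, re_ofReal_mul, I_re, mul_zero, add_zero]

theorem re_tailPolyDeriv (t : ℝ) : (tailPolyDeriv (1 / 2 + t * I)).re =
    -2 * (1 / 4 - t ^ 2) / (1 / 4 + t ^ 2) ^ 2 + 1 / 24 - (23 / 4 - 3 * t ^ 2) / 5760
      + (5 * t ^ 4 - 345 / 2 * t ^ 2 + 1689 / 16) / 967680 := by
  have hI : (I : ℂ) ^ 2 = -1 := I_sq
  have hd : (1 / 4 + t ^ 2 : ℝ) ≠ 0 := by positivity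
  have hd' : (1 / 4 + (t : ℂ) ^ 2) ≠ 0 := by
    have := ofReal_ne_zero.2 hd
    push_cast at this
    exact this
  have hs : (1 / 2 + t * I - 1 : ℂ) ≠ 0 := by
    intro h; have := congrArg re h; norm_num at this
  have e : tailPolyDeriv (1 / 2 + t * I) =
      ((-2 * (1 / 4 - t ^ 2) / (1 / 4 + t ^ 2) ^ 2 + 1 / 24 - (23 / 4 - 3 * t ^ 2) / 5760
      + (5 * t ^ 4 - 345 / 2 * t ^ 2 + 1689 / 16) / 967680 : ℝ) : ℂ) +
      ((-2 * t / (1 / 4 + t ^ 2) ^ 2 - 9 * t / 5760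
      + (5 / 2 * t + 30 * t + 105 * t + 100 * t - 10 * t ^ 3 - 40 * t ^ 3) / 967680 : ℝ) : ℂ)
        * I := by
    have h2 : (I : ℂ) ^ 3 = -I := by rw [pow_succ, hI]; ring
    have h4 : (I : ℂ) ^ 4 = 1 := I_pow_four
    have h1 : -2 / (1 / 2 + t * I - 1 : ℂ) ^ 2 =
        (-2 * (1 / 4 - (t : ℂ) ^ 2) - 2 * t * I) / (1 / 4 + (t : ℂ) ^ 2) ^ 2 := by
      rw [div_eq_div_iff (pow_ne_zero _ hs) (pow_ne_zero _ hd')]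
      ring_nf
      simp only [hI, h2]
      ring
    unfold tailPolyDeriv
    rw [h1]
    push_cast
    field_simp
    ring_nf
    simp only [hI, h2, h4]
    ring
  rw [e, add_re, ofReal_re, re_ofReal_mul, I_re, mul_zero, add_zero]

theorem re_tail_le {t : ℝ} (h5 : 5 ≤ t) (h7 : t ≤ 7) :
    (tailPolyDeriv (1 / 2 + t * I) - Real.log 2 * tailPoly (1 / 2 + t * I)).re ≤ -0.21 := by
  rw [sub_re, re_ofReal_mul, re_tailPoly, re_tailPolyDeriv]
  obtain ⟨v, hv⟩ : ∃ v, t ^ 2 = 25 + v := ⟨t ^ 2 - 25, by ring⟩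
  have hv0 : 0 ≤ v := by nlinarith
  have hv1 : v ≤ 24 := by nlinarith
  have h4 : t ^ 4 = (25 + v) ^ 2 := by rw [← hv]; ring
  rw [h4, hv]
  have hL : 0.6931 ≤ Real.log 2 := by linarith [Real.log_two_gt_d9]
  have hy : 0 < 1 / 4 + (25 + v) := by linarith
  have hB : 0 ≤ -1 / (1 / 4 + (25 + v)) + 25 / 48 - (15 / 8 - 9 / 2 * (25 + v)) / 5760
      + (25 / 2 * (25 + v) ^ 2 - 475 / 4 * (25 + v) + 945 / 32) / 967680 := by
    have : -1 / (1 / 4 + (25 + v)) ≥ -1 / 25 := by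
      rw [ge_iff_le, div_le_div_iff₀ (by norm_num) hy]; linarith
    nlinarith
  have h1 := mul_le_mul_of_nonneg_right hL hB
  refine (sub_le_sub_left h1 _).trans ?_
  rw [show -1 / (1 / 4 + (25 + v)) = -(1 / (1 / 4 + (25 + v))) by ring]
  have e : -2 * (1 / 4 - (25 + v)) / (1 / 4 + (25 + v)) ^ 2
      + 0.6931 * (1 / (1 / 4 + (25 + v))) ≤ 0.1066 - 0.0021 * v + 0.00005 * v ^ 2 := by
    rw [mul_one_div, div_add_div _ _ (by positivity) (by positivity),
      div_le_iff₀ (by positivity)]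
    nlinarith [mul_nonneg hv0 (by linarith : 0 ≤ 24 - v), pow_nonneg hv0 3]
  generalize -2 * (1 / 4 - (25 + v)) / (1 / 4 + (25 + v)) ^ 2 = a at e ⊢
  generalize 1 / (1 / 4 + (25 + v)) = b at e ⊢
  nlinarith [mul_nonneg hv0 (by linarith : 0 ≤ 24 - v)]

theorem norm_half_add_mul_I_add_le {t : ℝ} (h0 : 0 ≤ t) (h7 : t ≤ 7) {z : ℂ}
    (hz : ‖z - (1 / 2 + t * I)‖ ≤ 9 / 10) {a b : ℝ} (hb : 9 / 10 ≤ b)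
    (hab : (1 / 2 + a) ^ 2 + 49 ≤ (b - 9 / 10) ^ 2) : ‖z + a‖ ≤ b := by
  have h1 : ‖(1 / 2 + t * I + a : ℂ)‖ ≤ b - 9 / 10 := by
    refine abs_le_of_sq_le_sq' ?_ (by linarith) |>.2
    rw [← Complex.normSq_eq_norm_sq, show (1 / 2 + t * I + a : ℂ) = ((1 / 2 + a : ℝ) : ℂ) + t * I by
      push_cast; ring, Complex.normSq_add_mul_I]
    nlinarith
  calc ‖z + a‖ = ‖(z - (1 / 2 + t * I)) + (1 / 2 + t * I + a)‖ := by congr 1; ring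
    _ ≤ _ := norm_add_le _ _
    _ ≤ b := by linarith

theorem norm_rising_le_of_near {t : ℝ} (h0 : 0 ≤ t) (h7 : t ≤ 7) {z : ℂ}
    (hz : ‖z - (1 / 2 + t * I)‖ ≤ 9 / 10) : ‖rising z‖ ≤ 4400000 := by
  have key : ∀ {a b : ℝ}, 9 / 10 ≤ b → (1 / 2 + a) ^ 2 + 49 ≤ (b - 9 / 10) ^ 2 → ‖z + a‖ ≤ b :=
    fun hb hab => norm_half_add_mul_I_add_le h0 h7 hz hb hab
  have k0 := key (a := 0) (b := 7.919) (by norm_num) (by norm_num)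
  have k1 := key (a := 1) (b := 8.06) (by norm_num) (by norm_num)
  have k2 := key (a := 2) (b := 8.334) (by norm_num) (by norm_num)
  have k3 := key (a := 3) (b := 8.727) (by norm_num) (by norm_num)
  have k4 := key (a := 4) (b := 9.223) (by norm_num) (by norm_num)
  have k5 := key (a := 5) (b := 9.803) (by norm_num) (by norm_num)
  have k6 := key (a := 6) (b := 10.454) (by norm_num) (by norm_num)
  push_cast at k0 k1 k2 k3 k4 k5 k6
  rw [add_zero] at k0
  unfold rising
  simp only [norm_mul]
  calc _ ≤ (7.919 : ℝ) * 8.06 * 8.334 * 8.727 * 9.223 * 9.803 * 10.454 := by gcongr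
    _ ≤ 4400000 := by norm_num

theorem closedBall_subset_emRegion {t : ℝ} (h5 : 5 ≤ t) (h7 : t ≤ 7) :
    Metric.closedBall (1 / 2 + t * I : ℂ) (9 / 10) ⊆ emRegion := by
  intro z hz
  rw [mem_closedBall_iff_norm] at hz
  have hre := (abs_re_le_norm _).trans hz
  have him := (abs_im_le_norm _).trans hz
  have hn := norm_half_add_mul_I_add_le (a := 0) (b := 8) (by linarith) h7 hz (by norm_num)
    (by norm_num)
  rw [abs_le] at hre him
  simp at hre him
  refine ⟨⟨?_, ?_⟩, ?_⟩
  · simp only [Set.mem_ofPred_eq]; linarith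
  · simp only [Set.mem_ofPred_eq]; linarith
  · rw [mem_ball_zero_iff]
    rw [ofReal_zero, add_zero] at hn
    linarith

theorem norm_deriv_zetaRem_le {t : ℝ} (h5 : 5 ≤ t) (h7 : t ≤ 7) :
    ‖deriv zetaRem (1 / 2 + t * I)‖ ≤ 0.123 := by
  have hsub := closedBall_subset_emRegion h5 h7
  have hd : DiffContOnCl ℂ zetaRem (Metric.ball (1 / 2 + t * I : ℂ) (9 / 10)) :=
    (differentiableOn_zetaRem.mono hsub).diffContOnCl_ball subset_rfl
  refine (Complex.norm_deriv_le_of_forall_mem_sphere_norm_le (C := 0.1107) (by norm_num) hd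
    ?_).trans (by norm_num)
  intro z hz
  have hz' := Metric.sphere_subset_closedBall hz
  have hzr := hsub hz'
  refine (norm_zetaRem_le hzr.1.2.le (ne_one_of_mem_emRegion hzr)).trans ?_
  have h1 := norm_rising_le_of_near (by linarith) h7 (mem_closedBall_iff_norm.1 hz')
  have h2 : (2 : ℝ) ^ (-(11 / 2) : ℝ) ≤ 0.0222 := by
    refine abs_le_of_sq_le_sq' ?_ (by norm_num) |>.2
    rw [← Real.rpow_natCast, ← Real.rpow_mul (by norm_num),
      show (-(11 / 2) : ℝ) * (2 : ℕ) = ((-11 : ℤ) : ℝ) by norm_num, Real.rpow_intCast]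
    norm_num
  calc _ ≤ 0.0312 / 5040 * 4400000 * ((0.0222 : ℝ) / (11 / 2)) := by gcongr
    _ ≤ 0.1107 := by norm_num

theorem deriv_riemannZeta_ne_zero {t : ℝ} (h5 : 5 ≤ t) (h7 : t ≤ 7) :
    deriv riemannZeta (1 / 2 + t * I) ≠ 0 := by
  set s : ℂ := 1 / 2 + t * I with hs
  have hmem : s ∈ emRegion :=
    closedBall_subset_emRegion h5 h7 (Metric.mem_closedBall_self (by norm_num))
  have hnhds := isOpen_emRegion.mem_nhds hmem
  have hev : riemannZeta =ᶠ[nhds s] fun s => 1 + zetaTail s 2 + zetaRem s :=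
    Filter.eventuallyEq_of_mem hnhds riemannZeta_eqOn_emRegion
  have h1 := (hasDerivAt_zetaTail_two (ne_one_of_mem_emRegion hmem)).const_add 1
  have h2 := (differentiableOn_zetaRem.differentiableAt hnhds).hasDerivAt
  rw [hev.deriv_eq, HasDerivAt.deriv (f := fun s => 1 + zetaTail s 2 + zetaRem s) (h1.add h2)]
  intro h0
  have h3 := norm_deriv_zetaRem_le h5 h7
  have h4 := re_tail_le h5 h7
  rw [← hs] at h3 h4
  rw [eq_neg_of_add_eq_zero_right h0, norm_neg, norm_mul] at h3
  have h6 : 0.7 ≤ ‖(2 : ℂ) ^ (-s)‖ := by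
    rw [show (2 : ℂ) = ((2 : ℝ) : ℂ) by norm_num, Complex.norm_cpow_eq_rpow_re_of_pos two_pos]
    have : (-s).re = (-(1 / 2) : ℝ) := by simp [hs]
    rw [this]
    refine abs_le_of_sq_le_sq' ?_ (by positivity) |>.2
    rw [← Real.rpow_natCast (_ ^ _), ← Real.rpow_mul (by norm_num),
      show (-(1 / 2) : ℝ) * (2 : ℕ) = ((-1 : ℤ) : ℝ) by norm_num, Real.rpow_intCast]
    norm_num
  have h7 : 0.21 ≤ ‖tailPolyDeriv s - Real.log 2 * tailPoly s‖ := by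
    have := neg_le_of_abs_le (abs_re_le_norm (tailPolyDeriv s - Real.log 2 * tailPoly s))
    linarith
  have := mul_le_mul h6 h7 (by norm_num) (norm_nonneg _)
  norm_num at this h3
  linarith

/-- The derivative of `thetaTerm j`. -/
noncomputable def thetaSlope (j : ℕ) (y : ℝ) : ℝ :=
  Real.log (((j : ℝ) + 2) / (j + 1)) - ((j : ℝ) + 5 / 4) / (((j : ℝ) + 5 / 4) ^ 2 + y ^ 2)

/-- The terms of a series for the argument of `Γ (1 / 4 + y * I)`. -/
noncomputable def thetaTerm (j : ℕ) (y : ℝ) : ℝ :=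
  y * Real.log (((j : ℝ) + 2) / (j + 1)) - Real.arctan (y / ((j : ℝ) + 5 / 4))

/-- A continuous argument of `Γ (1 / 4 + y * I)`. -/
noncomputable def argGamma (y : ℝ) : ℝ := -Real.arctan (4 * y) + ∑' j, thetaTerm j y

/-- The derivative of `argGamma`. -/
noncomputable def argGammaDeriv (y : ℝ) : ℝ :=
  -((1 / 4) / (1 / 16 + y ^ 2)) + ∑' j, thetaSlope j y

/-- The Riemann–Siegel theta function. -/
noncomputable def theta (t : ℝ) : ℝ := argGamma (t / 2) - t / 2 * Real.log Real.pi

theorem hasDerivAt_arctan_div {x : ℝ} (hx : 0 < x) (y : ℝ) :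
    HasDerivAt (fun y => Real.arctan (y / x)) (x / (x ^ 2 + y ^ 2)) y := by
  refine ((hasDerivAt_id y).div_const x).arctan.congr_deriv ?_
  simp only [id]
  have : x ^ 2 + y ^ 2 ≠ 0 := by positivity
  field_simp

theorem hasDerivAt_thetaTerm (j : ℕ) (y : ℝ) : HasDerivAt (thetaTerm j) (thetaSlope j y) y := by
  refine (((hasDerivAt_id y).mul_const (Real.log (((j : ℝ) + 2) / (j + 1)))).sub
    (hasDerivAt_arctan_div (x := (j : ℝ) + 5 / 4) (by positivity) y)).congr_deriv ?_
  rw [one_mul, thetaSlope]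

theorem log_ratio_le (a : ℝ) (ha : 0 < a) : Real.log ((a + 1) / a) ≤ 1 / a := by
  refine (Real.log_le_sub_one_of_pos (by positivity)).trans (le_of_eq ?_)
  field_simp; ring

theorem le_log_ratio (a : ℝ) (ha : 0 < a) : 1 / (a + 1 / 2) ≤ Real.log ((a + 1) / a) := by
  have := Real.le_log_one_add_of_nonneg (x := 1 / a) (by positivity)
  refine (le_of_eq ?_).trans (this.trans (le_of_eq ?_))
  · field_simp; ring
  · congr 1; field_simp

theorem abs_thetaSlope_le (j : ℕ) (y : ℝ) :
    |thetaSlope j y| ≤ (1 + y ^ 2) * (1 / ((j : ℝ) + 1) ^ 2) := by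
  have ha : (0 : ℝ) < (j : ℝ) + 1 := by positivity
  set a : ℝ := (j : ℝ) + 1 with haa
  have h1 := log_ratio_le a ha
  have h2 := le_log_ratio a ha
  have e1 : (j : ℝ) + 2 = a + 1 := by rw [haa]; ring
  have e2 : (j : ℝ) + 5 / 4 = a + 1 / 4 := by rw [haa]; ring
  rw [thetaSlope, e1, e2]
  have ha1 : 1 ≤ a := by rw [haa]; linarith [(Nat.cast_nonneg j : (0 : ℝ) ≤ j)]
  have hy : 0 ≤ y ^ 2 := sq_nonneg y
  have b1 : (a + 1 / 4) / ((a + 1 / 4) ^ 2 + y ^ 2) ≤ 1 / (a + 1 / 4) := by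
    rw [div_le_div_iff₀ (by positivity) (by positivity)]; nlinarith
  have b2 : 1 / a - (1 + y ^ 2) * (1 / a ^ 2) ≤ (a + 1 / 4) / ((a + 1 / 4) ^ 2 + y ^ 2) := by
    have : 1 / a - (1 + y ^ 2) * (1 / a ^ 2) = (a - 1 - y ^ 2) / a ^ 2 := by field_simp; ring
    rw [this, div_le_div_iff₀ (by positivity) (by positivity)]
    nlinarith [mul_nonneg hy hy, mul_nonneg hy ha.le, mul_nonneg ha.le ha.le,
      mul_nonneg (mul_nonneg ha.le ha.le) ha.le]
  have b3 : 1 / (a + 1 / 4) - 1 / (a + 1 / 2) ≤ (1 + y ^ 2) * (1 / a ^ 2) := by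
    have : 1 / (a + 1 / 4) - 1 / (a + 1 / 2) ≤ 1 / a ^ 2 := by
      rw [div_sub_div _ _ (by positivity) (by positivity),
        div_le_div_iff₀ (by positivity) (by positivity)]
      nlinarith
    have h : 0 < 1 / a ^ 2 := by positivity
    nlinarith
  rw [abs_le]
  constructor <;> linarith

theorem summable_inv_succ_sq : Summable fun j : ℕ => 1 / ((j : ℝ) + 1) ^ 2 := by
  have := (summable_nat_add_iff (f := fun n : ℕ => 1 / (n : ℝ) ^ 2) 1).2
    (Real.summable_one_div_nat_pow.2 one_lt_two)
  simpa using this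

theorem summable_thetaSlope (y : ℝ) : Summable fun j => thetaSlope j y :=
  Summable.of_norm_bounded (summable_inv_succ_sq.mul_left (1 + y ^ 2)) fun j =>
    abs_thetaSlope_le j y

theorem abs_thetaSlope_le_of_mem_ball {R : ℝ} (j : ℕ) {y : ℝ} (hy : y ∈ Metric.ball (0 : ℝ) R) :
    ‖thetaSlope j y‖ ≤ (1 + R ^ 2) * (1 / ((j : ℝ) + 1) ^ 2) := by
  refine (abs_thetaSlope_le j y).trans (mul_le_mul_of_nonneg_right ?_ (by positivity))
  rw [mem_ball_zero_iff, Real.norm_eq_abs] at hy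
  have := sq_lt_sq' (by linarith [abs_nonneg y]) hy
  rw [sq_abs] at this
  linarith

theorem summable_thetaTerm (y : ℝ) : Summable fun j => thetaTerm j y :=
  summable_of_summable_hasDerivAt_of_isPreconnected
    (summable_inv_succ_sq.mul_left (1 + (|y| + 1) ^ 2)) Metric.isOpen_ball
    (convex_ball (0 : ℝ) (|y| + 1)).isPreconnected (fun j y _ => hasDerivAt_thetaTerm j y)
    (fun j y hy => abs_thetaSlope_le_of_mem_ball j hy)
    (y₀ := 0) (by simp; positivity) (by simp [thetaTerm])
    (by simp)

theorem hasDerivAt_argGamma (y : ℝ) : HasDerivAt argGamma (argGammaDeriv y) y := by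
  have h1 : HasDerivAt (fun y => ∑' j, thetaTerm j y) (∑' j, thetaSlope j y) y :=
    hasDerivAt_tsum_of_isPreconnected
      (summable_inv_succ_sq.mul_left (1 + (|y| + 1) ^ 2)) Metric.isOpen_ball
      (convex_ball (0 : ℝ) (|y| + 1)).isPreconnected (fun j y _ => hasDerivAt_thetaTerm j y)
      (fun j y hy => abs_thetaSlope_le_of_mem_ball j hy)
      (y₀ := 0) (by simp; positivity) (by simp [thetaTerm])
      (by simp)
  have h2 := (hasDerivAt_arctan_div (x := 1 / 4) (by norm_num) y).neg
  refine (h2.add h1).congr_of_eventuallyEq ?_ |>.congr_deriv ?_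
  · refine Filter.Eventually.of_forall fun z => ?_
    simp only [argGamma, Pi.add_apply, Pi.neg_apply]
    rw [show z / (1 / 4) = 4 * z by ring]
  · rw [argGammaDeriv]; norm_num

theorem thetaSlope_mono (j : ℕ) {y z : ℝ} (hy : 0 ≤ y) (hyz : y ≤ z) :
    thetaSlope j y ≤ thetaSlope j z := by
  unfold thetaSlope
  gcongr

theorem argGammaDeriv_strictMono {y z : ℝ} (hy : 0 ≤ y) (hyz : y < z) :
    argGammaDeriv y < argGammaDeriv z := by
  unfold argGammaDeriv
  refine add_lt_add_of_lt_of_le ?_ ((summable_thetaSlope y).tsum_le_tsum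
    (fun j => thetaSlope_mono j hy hyz.le) (summable_thetaSlope z))
  rw [neg_lt_neg_iff]
  gcongr

theorem argGammaDeriv_neg (y : ℝ) : argGammaDeriv (-y) = argGammaDeriv y := by
  simp [argGammaDeriv, thetaSlope]

theorem argGamma_neg (y : ℝ) : argGamma (-y) = -argGamma y := by
  have : ∀ j, thetaTerm j (-y) = -thetaTerm j y := by
    intro j
    simp only [thetaTerm, neg_div, Real.arctan_neg]
    ring
  simp only [argGamma, this, tsum_neg, mul_neg, Real.arctan_neg]
  ring

theorem theta_neg (t : ℝ) : theta (-t) = -theta t := by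
  simp only [theta, neg_div, argGamma_neg]
  ring

theorem hasDerivAt_theta (t : ℝ) :
    HasDerivAt theta ((argGammaDeriv (t / 2) - Real.log Real.pi) / 2) t := by
  have hid := (hasDerivAt_id' t).div_const 2
  have h1 := (hasDerivAt_argGamma (t / 2)).comp t hid
  refine (h1.sub (hid.mul_const (Real.log Real.pi))).congr_deriv ?_
  ring

theorem le_tsum_of_telescope {a g : ℕ → ℝ} (ha : Summable a)
    (hg : Filter.Tendsto g Filter.atTop (nhds 0)) (J : ℕ)
    (h : ∀ j, J ≤ j → g j - g (j + 1) ≤ a j) : ∑ j ∈ Finset.range J, a j + g J ≤ ∑' j, a j := by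
  have h1 : ∀ n, J ≤ n → ∑ j ∈ Finset.range J, a j + g J - g n ≤ ∑ j ∈ Finset.range n, a j := by
    intro n hn
    induction n, hn using Nat.le_induction with
    | base => linarith
    | succ n hn ih =>
      rw [Finset.sum_range_succ]
      linarith [h n hn]
  have h2 := hg.const_sub (∑ j ∈ Finset.range J, a j + g J)
  rw [sub_zero] at h2
  exact le_of_tendsto_of_tendsto h2 ha.hasSum.tendsto_sum_nat
    (Filter.eventually_atTop.2 ⟨J, h1⟩)

theorem tendsto_div_add_natCast (c d : ℝ) :
    Filter.Tendsto (fun j : ℕ => c / ((j : ℝ) + d)) Filter.atTop (nhds 0) :=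
  Filter.Tendsto.div_atTop tendsto_const_nhds
    (Filter.tendsto_atTop_add_const_right _ _ tendsto_natCast_atTop_atTop)

theorem sum_thetaSlope (J : ℕ) (y : ℝ) : ∑ j ∈ Finset.range J, thetaSlope j y =
    Real.log (J + 1) -
      ∑ j ∈ Finset.range J, ((j : ℝ) + 5 / 4) / (((j : ℝ) + 5 / 4) ^ 2 + y ^ 2) := by
  have : ∑ j ∈ Finset.range J, Real.log (((j : ℝ) + 2) / (j + 1)) = Real.log (J + 1) := by
    induction J with
    | zero => simp
    | succ J ih =>
      rw [Finset.sum_range_succ, ih, Real.log_div (by positivity) (by positivity)]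
      push_cast
      rw [show (J : ℝ) + 1 + 1 = J + 2 by ring]
      ring
  simp only [thetaSlope, Finset.sum_sub_distrib, this]

theorem log_sixteen : Real.log (((15 : ℕ) : ℝ) + 1) = 4 * Real.log 2 := by
  rw [show ((15 : ℕ) : ℝ) + 1 = 2 ^ 4 by norm_num, Real.log_pow]; norm_num

theorem lt_argGammaDeriv : 1.1558 < argGammaDeriv (7 / 2) := by
  have h := le_tsum_of_telescope (summable_thetaSlope (7 / 2))
    (tendsto_div_add_natCast (-(1 / 4)) (7 / 8)) 15 (fun j _ => by
      refine le_trans ?_ (sub_le_sub_right (show 1 / ((j : ℝ) + 1 + 1 / 2) ≤ _ from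
        (le_log_ratio ((j : ℝ) + 1) (by positivity)).trans (le_of_eq (by ring_nf))) _)
      refine le_trans ?_ (sub_le_sub_left (show _ ≤ 1 / ((j : ℝ) + 5 / 4) from ?_) _)
      · push_cast
        rw [div_sub_div _ _ (by positivity) (by positivity), div_sub_div _ _ (by positivity)
          (by positivity), div_le_div_iff₀ (by positivity) (by positivity)]
        have : (0 : ℝ) ≤ j := j.cast_nonneg
        nlinarith
      · rw [div_le_div_iff₀ (by positivity) (by positivity)]
        nlinarith)
  rw [sum_thetaSlope, log_sixteen] at h
  simp only [Finset.sum_range_succ, Finset.sum_range_zero] at h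
  norm_num at h
  unfold argGammaDeriv
  have := Real.log_two_gt_d9
  norm_num
  linarith

theorem argGammaDeriv_lt : argGammaDeriv (5 / 2) < 1.1347 := by
  have h := le_tsum_of_telescope (summable_thetaSlope (5 / 2)).neg
    (tendsto_div_add_natCast (-0.7) (5 / 8)) 15 (fun j hj => by
      have hj' : (15 : ℝ) ≤ j := by exact_mod_cast hj
      rw [thetaSlope, neg_sub]
      refine le_trans ?_ (sub_le_sub_left (show _ ≤ 1 / ((j : ℝ) + 1) from
        (le_of_eq (by ring_nf)).trans (log_ratio_le ((j : ℝ) + 1) (by positivity))) _)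
      push_cast
      generalize (j : ℝ) = b at hj' ⊢
      obtain ⟨a, rfl⟩ : ∃ a : ℝ, b = a + 15 := ⟨b - 15, by ring⟩
      have ha : 0 ≤ a := by linarith
      rw [div_sub_div _ _ (by positivity) (by positivity), div_sub_div _ _ (by positivity)
        (by positivity), div_le_div_iff₀ (by positivity) (by positivity), ← sub_nonneg]
      ring_nf
      positivity)
  rw [Finset.sum_neg_distrib, sum_thetaSlope, log_sixteen, tsum_neg] at h
  simp only [Finset.sum_range_succ, Finset.sum_range_zero] at h
  norm_num at h
  unfold argGammaDeriv
  have := Real.log_two_lt_d9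
  norm_num
  linarith

theorem log_pi_bounds : 1.1347 < Real.log Real.pi ∧ Real.log Real.pi < 1.1558 := by
  have e : Real.log Real.pi = 1 + Real.log (Real.pi / Real.exp 1) := by
    rw [Real.log_div Real.pi_ne_zero (Real.exp_ne_zero _), Real.log_exp]; ring
  have hp := Real.pi_gt_d6
  have hp' := Real.pi_lt_d6
  have he := Real.exp_one_gt_d9
  have he' := Real.exp_one_lt_d9
  rw [e]
  constructor
  · have h := Real.one_sub_inv_le_log_of_pos (x := Real.pi / Real.exp 1) (by positivity)
    have : (Real.pi / Real.exp 1)⁻¹ < 0.8653 := by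
      rw [inv_div, div_lt_iff₀ Real.pi_pos]; linarith
    linarith
  · have h := Real.log_le_sub_one_of_pos (x := Real.pi / Real.exp 1) (by positivity)
    have : Real.pi / Real.exp 1 < 1.1558 := by
      rw [div_lt_iff₀ (Real.exp_pos 1)]; linarith
    linarith

theorem one_add_mul_I_eq_exp_arctan (v : ℝ) :
    (1 + v * I : ℂ) = (1 - v * I) * cexp (2 * I * Real.arctan v) := by
  have h0 : Real.cos (Real.arctan v) ≠ 0 := (Real.cos_arctan_pos v).ne'
  have h1 : Real.sin (Real.arctan v) = v * Real.cos (Real.arctan v) := by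
    have := Real.tan_arctan v
    rw [Real.tan_eq_sin_div_cos, div_eq_iff h0] at this
    exact this
  have h2 : (1 + v ^ 2) * Real.cos (Real.arctan v) ^ 2 = 1 := by
    rw [Real.cos_sq_arctan]; field_simp
  have h3 : cexp (2 * I * Real.arctan v) = (Real.cos (Real.arctan v) * (1 + v * I)) ^ 2 := by
    rw [show (2 * I * Real.arctan v : ℂ) = (2 : ℕ) * (Real.arctan v * I) by push_cast; ring,
      Complex.exp_nat_mul, Complex.exp_mul_I, ← Complex.ofReal_cos, ← Complex.ofReal_sin, h1]
    push_cast
    ring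
  have h2' : (1 + (v : ℂ) ^ 2) * (Real.cos (Real.arctan v) : ℂ) ^ 2 = 1 := by exact_mod_cast h2
  rw [h3]
  linear_combination (-(1 + v * I)) * h2' +
    ((Real.cos (Real.arctan v) : ℂ) ^ 2 * v ^ 2 * (1 + v * I)) * I_sq

theorem GammaSeq_eq_mul_exp (y : ℝ) {n : ℕ} (hn : n ≠ 0) :
    GammaSeq (1 / 4 + y * I) n = GammaSeq (1 / 4 - y * I) n *
      cexp (2 * I * ((y * Real.log n -
        ∑ j ∈ Finset.range (n + 1), Real.arctan (y / ((j : ℝ) + 1 / 4)) : ℝ) : ℂ)) := by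
  have hn' : (n : ℂ) ≠ 0 := by exact_mod_cast hn
  have h1 : (n : ℂ) ^ (1 / 4 + y * I : ℂ) =
      (n : ℂ) ^ (1 / 4 - y * I : ℂ) * cexp (2 * I * (y * Real.log n : ℝ)) := by
    rw [cpow_def_of_ne_zero hn', cpow_def_of_ne_zero hn', ← Complex.exp_add, ← natCast_log]
    congr 1
    push_cast
    ring
  have h2 : ∀ j : ℕ, (1 / 4 + y * I + j : ℂ) = (1 / 4 - y * I + j) *
      cexp (2 * I * (Real.arctan (y / ((j : ℝ) + 1 / 4)) : ℝ)) := by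
    intro j
    have hx : ((j : ℂ) + 1 / 4) ≠ 0 := by
      have : ((j : ℝ) + 1 / 4) ≠ 0 := by positivity
      have := ofReal_ne_zero.2 this
      push_cast at this
      exact this
    have h := one_add_mul_I_eq_exp_arctan (y / ((j : ℝ) + 1 / 4))
    have h' := congrArg (fun z => ((j : ℂ) + 1 / 4) * z) h
    simp only [← mul_assoc] at h'
    generalize cexp (2 * I * (Real.arctan (y / ((j : ℝ) + 1 / 4)) : ℝ)) = E at h' ⊢
    push_cast at h'
    have e0 : ((j : ℂ) + 1 / 4) * (y / (j + 1 / 4)) = y := mul_div_cancel₀ _ hx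
    have e1 : ((j : ℂ) + 1 / 4) * (1 + y / (j + 1 / 4) * I) = 1 / 4 + y * I + j := by
      linear_combination I * e0
    have e2 : ((j : ℂ) + 1 / 4) * (1 - y / (j + 1 / 4) * I) = 1 / 4 - y * I + j := by
      linear_combination -I * e0
    rwa [e1, e2] at h'
  have h3 : ∏ j ∈ Finset.range (n + 1), (1 / 4 + y * I + j : ℂ) =
      (∏ j ∈ Finset.range (n + 1), (1 / 4 - y * I + j : ℂ)) *
      cexp (2 * I * ((∑ j ∈ Finset.range (n + 1), Real.arctan (y / ((j : ℝ) + 1 / 4)) : ℝ) : ℂ)) := by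
    rw [Finset.prod_congr rfl fun j _ => h2 j, Finset.prod_mul_distrib, ← Complex.exp_sum,
      ← Finset.mul_sum, ofReal_sum]
  rw [GammaSeq, GammaSeq, h1, h3, ofReal_sub, mul_sub, Complex.exp_sub]
  generalize (∑ j ∈ Finset.range (n + 1), Real.arctan (y / ((j : ℝ) + 1 / 4)) : ℝ) = A
  generalize (∏ j ∈ Finset.range (n + 1), (1 / 4 - y * I + j : ℂ)) = P
  ring

theorem tendsto_sum_arctan (y : ℝ) :
    Filter.Tendsto (fun n : ℕ => y * Real.log n -
      ∑ j ∈ Finset.range (n + 1), Real.arctan (y / ((j : ℝ) + 1 / 4))) Filter.atTop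
      (nhds (argGamma y)) := by
  have h1 := (summable_thetaTerm y).hasSum.tendsto_sum_nat.const_add (-Real.arctan (4 * y))
  have h2 : Filter.Tendsto (fun n : ℕ => Real.log (((n : ℝ) + 1) / n)) Filter.atTop (nhds 0) := by
    refine squeeze_zero' ?_ ?_ (tendsto_div_add_natCast 1 0)
    · filter_upwards [Filter.eventually_gt_atTop 0] with n hn
      have hn' : (0 : ℝ) < n := by exact_mod_cast hn
      exact Real.log_nonneg (by rw [le_div_iff₀ hn']; linarith)
    · filter_upwards [Filter.eventually_gt_atTop 0] with n hn
      rw [add_zero]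
      exact log_ratio_le n (by exact_mod_cast hn)
  have h3 := h1.sub (h2.const_mul y)
  rw [mul_zero, sub_zero] at h3
  refine h3.congr' ?_
  filter_upwards [Filter.eventually_gt_atTop 0] with n hn
  have hn' : (n : ℝ) ≠ 0 := by exact_mod_cast hn.ne'
  have h4 : ∑ j ∈ Finset.range n, thetaTerm j y = y * Real.log (n + 1) -
      ∑ j ∈ Finset.range n, Real.arctan (y / ((j : ℝ) + 5 / 4)) := by
    have := sum_thetaSlope n 0
    simp only [thetaSlope, Finset.sum_sub_distrib] at this
    simp only [thetaTerm, Finset.sum_sub_distrib, ← Finset.mul_sum]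
    rw [sub_left_inj.1 this]
  rw [h4, Finset.sum_range_succ', Real.log_div (by positivity) hn']
  have h5 : ∀ j : ℕ, ((j + 1 : ℕ) : ℝ) + 1 / 4 = j + 5 / 4 := by intro j; push_cast; ring
  simp only [h5]
  rw [show y / (((0 : ℕ) : ℝ) + 1 / 4) = 4 * y by push_cast; ring]
  ring

theorem Gamma_eq_mul_exp_argGamma (y : ℝ) :
    Complex.Gamma (1 / 4 + y * I) =
      Complex.Gamma (1 / 4 - y * I) * cexp (2 * I * argGamma y) := by
  have h1 := GammaSeq_tendsto_Gamma (1 / 4 + y * I)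
  have hc : Continuous fun x : ℝ => cexp (2 * I * x) := by fun_prop
  have h2 := (GammaSeq_tendsto_Gamma (1 / 4 - y * I)).mul
    ((hc.tendsto _).comp (tendsto_sum_arctan y))
  refine tendsto_nhds_unique h1 (h2.congr' ?_)
  filter_upwards [Filter.eventually_gt_atTop 0] with n hn
  exact (GammaSeq_eq_mul_exp y hn.ne').symm

theorem analyticAt_argGamma (a : ℝ) : AnalyticAt ℝ argGamma a := by
  set G : ℂ → ℂ := fun s => (Complex.Gamma s)⁻¹ with hG
  have hGa : ∀ s, AnalyticAt ℝ G s := fun s =>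
    (differentiable_one_div_Gamma.analyticAt s).restrictScalars
  have hre : ∀ y : ℝ, Complex.Gamma (1 / 4 - y * I) ≠ 0 := fun y =>
    Gamma_ne_zero_of_re_pos (by simp)
  have hre' : ∀ y : ℝ, Complex.Gamma (1 / 4 + y * I) ≠ 0 := fun y =>
    Gamma_ne_zero_of_re_pos (by simp)
  have hI : ∀ y : ℝ, AnalyticAt ℝ (fun y : ℝ => (y : ℂ) * I) y := fun y =>
    (ofRealCLM.analyticAt y).mul analyticAt_const
  set v : ℝ → ℂ := fun y => G (1 / 4 - y * I) / G (1 / 4 + y * I) * cexp (-(2 * I * argGamma a))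
    with hv
  have hva : AnalyticAt ℝ v a := by
    refine AnalyticAt.mul (AnalyticAt.div ?_ ?_ (inv_ne_zero (hre' a))) analyticAt_const
    · exact AnalyticAt.comp (f := fun y : ℝ => (1 / 4 - y * I : ℂ)) (hGa _)
        (analyticAt_const.sub (hI a))
    · exact AnalyticAt.comp (f := fun y : ℝ => (1 / 4 + y * I : ℂ)) (hGa _)
        (analyticAt_const.add (hI a))
  have hvy : ∀ y, v y = cexp ((2 * (argGamma y - argGamma a) : ℝ) * I) := by
    intro y
    have := hre y
    simp only [hv, hG]
    rw [Gamma_eq_mul_exp_argGamma y, inv_div_inv, mul_div_cancel_left₀ _ this, ← Complex.exp_add]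
    congr 1
    push_cast
    ring
  have hlog : AnalyticAt ℝ (fun y => (Complex.log (v y)).im) a := by
    have h1 : AnalyticAt ℝ Complex.log (v a) :=
      (analyticAt_clog (by rw [hvy]; simp)).restrictScalars
    exact AnalyticAt.comp (f := fun y => Complex.log (v y)) (imCLM.analyticAt _) (h1.comp hva)
  refine ((hlog.mul (analyticAt_const (v := (1 / 2 : ℝ)))).add
    (analyticAt_const (v := argGamma a))).congr ?_
  have hcont : ContinuousAt (fun y => 2 * (argGamma y - argGamma a)) a :=
    ((hasDerivAt_argGamma a).continuousAt.sub continuousAt_const).const_mul 2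
  have hev : ∀ᶠ y in nhds a, 2 * (argGamma y - argGamma a) ∈ Set.Ioo (-Real.pi) Real.pi := by
    refine hcont.eventually_mem ?_
    simp only [sub_self, mul_zero]
    exact Ioo_mem_nhds (neg_neg_of_pos Real.pi_pos) Real.pi_pos
  filter_upwards [hev] with y hy
  simp only [Pi.add_apply, Pi.mul_apply]
  rw [hvy, Complex.log_exp (by simpa using hy.1) (by simpa using hy.2.le)]
  simp
  ring

theorem analyticAt_theta (t : ℝ) : AnalyticAt ℝ theta t :=
  (AnalyticAt.comp (f := fun t : ℝ => t / 2) (analyticAt_argGamma _)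
    (analyticAt_id.div_const)).sub ((analyticAt_id.div_const).mul analyticAt_const)

theorem Gammaℝ_eq_mul_exp_theta (t : ℝ) :
    Gammaℝ (1 / 2 + t * I) = Gammaℝ (1 / 2 - t * I) * cexp (2 * I * theta t) := by
  have h := Gamma_eq_mul_exp_argGamma (t / 2)
  have hpi : (Real.pi : ℂ) ≠ 0 := ofReal_ne_zero.2 Real.pi_ne_zero
  rw [Gammaℝ_def, Gammaℝ_def,
    show (1 / 2 + t * I : ℂ) / 2 = 1 / 4 + ((t / 2 : ℝ) : ℂ) * I by push_cast; ring,
    show (1 / 2 - t * I : ℂ) / 2 = 1 / 4 - ((t / 2 : ℝ) : ℂ) * I by push_cast; ring, h,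
    cpow_def_of_ne_zero hpi, cpow_def_of_ne_zero hpi]
  have e : cexp (Complex.log Real.pi * (-(1 / 2 + t * I) / 2)) * cexp (2 * I * argGamma (t / 2)) =
      cexp (Complex.log Real.pi * (-(1 / 2 - t * I) / 2)) * cexp (2 * I * theta t) := by
    rw [← Complex.exp_add, ← Complex.exp_add, ← ofReal_log Real.pi_pos.le, theta]
    congr 1
    push_cast
    ring
  linear_combination Complex.Gamma (1 / 4 - ((t / 2 : ℝ) : ℂ) * I) * e

theorem conj_half_add (t : ℝ) : (starRingEnd ℂ) (1 / 2 + t * I) = 1 / 2 - t * I := by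
  simp [map_ofNat]; ring

theorem conj_riemannZeta_half (t : ℝ) :
    (starRingEnd ℂ) (riemannZeta (1 / 2 + t * I)) =
      riemannZeta (1 / 2 + t * I) * cexp (2 * I * theta t) := by
  have h0 : (1 / 2 + t * I : ℂ) ≠ 0 := by
    intro h; have := congrArg re h; norm_num at this
  have h0' : (1 / 2 - t * I : ℂ) ≠ 0 := by
    intro h; have := congrArg re h; norm_num at this
  have hg : Gammaℝ (1 / 2 - t * I) ≠ 0 := Gammaℝ_ne_zero_of_re_pos (by simp)
  have hfe := completedRiemannZeta_one_sub (1 / 2 + t * I)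
  rw [show (1 - (1 / 2 + t * I) : ℂ) = 1 / 2 - t * I by ring] at hfe
  rw [← riemannZeta_conj, conj_half_add, riemannZeta_def_of_ne_zero h0,
    riemannZeta_def_of_ne_zero h0', hfe, Gammaℝ_eq_mul_exp_theta]
  have := Complex.exp_ne_zero (2 * I * theta t)
  field_simp

theorem exists_theta_eq_add_int_mul_pi {a b : ℝ}
    (hab : riemannZeta (1 / 2 + a * I) = riemannZeta (1 / 2 + b * I))
    (h0 : riemannZeta (1 / 2 + a * I) ≠ 0) : ∃ k : ℤ, theta b = theta a + k * Real.pi := by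
  have ha := conj_riemannZeta_half a
  have hb := conj_riemannZeta_half b
  rw [← hab, ha] at hb
  have h := mul_left_cancel₀ h0 hb
  obtain ⟨k, hk⟩ := Complex.exp_eq_exp_iff_exists_int.1 h.symm
  refine ⟨k, ?_⟩
  have h2 : (2 * I : ℂ) * (theta b - (theta a + k * Real.pi)) = 0 := by linear_combination hk
  have h3 := (mul_eq_zero.1 h2).resolve_left (mul_ne_zero two_ne_zero I_ne_zero)
  exact_mod_cast sub_eq_zero.1 h3

theorem deriv_theta (t : ℝ) :
    deriv theta t = (argGammaDeriv (t / 2) - Real.log Real.pi) / 2 :=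
  (hasDerivAt_theta t).deriv

theorem deriv_theta_neg (t : ℝ) : deriv theta (-t) = deriv theta t := by
  rw [deriv_theta, deriv_theta, neg_div, argGammaDeriv_neg]

theorem deriv_theta_strictMonoOn : StrictMonoOn (deriv theta) (Set.Ici 0) := by
  intro a ha b _ hab
  have ha' : 0 ≤ a := ha
  have := argGammaDeriv_strictMono (y := a / 2) (z := b / 2) (by linarith) (by linarith)
  rw [deriv_theta, deriv_theta]
  linarith

theorem exists_deriv_theta_eq_zero : ∃ t₀ : ℝ, 5 ≤ t₀ ∧ t₀ ≤ 7 ∧ deriv theta t₀ = 0 := by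
  have hc : ContinuousOn (deriv theta) (Set.Icc 5 7) := fun t _ =>
    (analyticAt_theta t).deriv.continuousAt.continuousWithinAt
  have h5 : deriv theta 5 ≤ 0 := by
    rw [deriv_theta]; linarith [argGammaDeriv_lt, log_pi_bounds.1]
  have h7 : 0 ≤ deriv theta 7 := by
    rw [deriv_theta]; linarith [lt_argGammaDeriv, log_pi_bounds.2]
  obtain ⟨t, ht, h⟩ := intermediate_value_Icc (by norm_num) hc ⟨h5, h7⟩
  exact ⟨t, ht.1, ht.2, h⟩

theorem differentiable_theta : Differentiable ℝ theta := fun t =>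
  (analyticAt_theta t).differentiableAt

theorem tendsto_theta_atTop : Filter.Tendsto theta Filter.atTop Filter.atTop := by
  have h7 : 0 < deriv theta 7 := by
    rw [deriv_theta]; linarith [lt_argGammaDeriv, log_pi_bounds.2]
  have hlin : Filter.Tendsto (fun t : ℝ => deriv theta 7 * (t - 7) + theta 7)
      Filter.atTop Filter.atTop :=
    Filter.tendsto_atTop_add_const_right _ _
      ((Filter.tendsto_atTop_add_const_right _ (-7) Filter.tendsto_id).const_mul_atTop h7)
  refine Filter.tendsto_atTop_mono' _ ?_ hlin
  filter_upwards [Filter.eventually_ge_atTop 7] with t ht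
  have := (convex_Ici (7 : ℝ)).mul_sub_le_image_sub_of_le_deriv
    differentiable_theta.continuous.continuousOn differentiable_theta.differentiableOn
    (C := deriv theta 7) (fun x hx => by
      rw [interior_Ici] at hx
      exact (deriv_theta_strictMonoOn.monotoneOn) (by norm_num : (0 : ℝ) ≤ 7)
        ((by norm_num : (0 : ℝ) ≤ 7).trans (le_of_lt hx)) (le_of_lt hx))
    7 Set.self_mem_Ici t ht ht
  linarith

/-- The open intervals on which `theta` is strictly monotone, in terms of the positive
critical point `t₀`. -/
def thetaInterval (t₀ : ℝ) : Fin 3 → Set ℝ :=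
  ![Set.Iio (-t₀), Set.Ioo (-t₀) t₀, Set.Ioi t₀]

section Critical

variable {t₀ : ℝ}

theorem deriv_theta_neg_of_abs_lt (h₀ : 0 < t₀) (h : deriv theta t₀ = 0) {t : ℝ}
    (ht : |t| < t₀) : deriv theta t < 0 := by
  have h1 : deriv theta |t| = deriv theta t := by
    rcases abs_choice t with e | e <;> rw [e]
    exact deriv_theta_neg t
  rw [← h1, ← h]
  exact deriv_theta_strictMonoOn (abs_nonneg t) h₀.le ht

theorem deriv_theta_pos_of_lt_abs (h₀ : 0 < t₀) (h : deriv theta t₀ = 0) {t : ℝ}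
    (ht : t₀ < |t|) : 0 < deriv theta t := by
  have h1 : deriv theta |t| = deriv theta t := by
    rcases abs_choice t with e | e <;> rw [e]
    exact deriv_theta_neg t
  rw [← h1, ← h]
  exact deriv_theta_strictMonoOn h₀.le (abs_nonneg t) ht

theorem theta_strictMonoOn_Ici (h₀ : 0 < t₀) (h : deriv theta t₀ = 0) :
    StrictMonoOn theta (Set.Ici t₀) := by
  refine strictMonoOn_of_deriv_pos (convex_Ici _)
    differentiable_theta.continuous.continuousOn fun x hx => ?_
  rw [interior_Ici] at hx
  exact deriv_theta_pos_of_lt_abs h₀ h (lt_of_lt_of_le hx (le_abs_self x))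

theorem theta_strictMonoOn_Iic (h₀ : 0 < t₀) (h : deriv theta t₀ = 0) :
    StrictMonoOn theta (Set.Iic (-t₀)) := by
  intro a ha b hb hab
  have ha' : a ≤ -t₀ := ha
  have hb' : b ≤ -t₀ := hb
  have := theta_strictMonoOn_Ici h₀ h (le_neg_of_le_neg hb') (le_neg_of_le_neg ha')
    (neg_lt_neg hab)
  rw [theta_neg, theta_neg] at this
  linarith

theorem theta_strictAntiOn_Icc (h₀ : 0 < t₀) (h : deriv theta t₀ = 0) :
    StrictAntiOn theta (Set.Icc (-t₀) t₀) := by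
  refine strictAntiOn_of_deriv_neg (convex_Icc _ _)
    differentiable_theta.continuous.continuousOn fun x hx => ?_
  rw [interior_Icc] at hx
  exact deriv_theta_neg_of_abs_lt h₀ h (abs_lt.2 hx)

theorem theta_lt_zero (h₀ : 0 < t₀) (h : deriv theta t₀ = 0) : theta t₀ < 0 := by
  have := theta_strictAntiOn_Icc h₀ h (Set.left_mem_Icc.2 (by linarith))
    (Set.right_mem_Icc.2 (by linarith)) (by linarith)
  rw [theta_neg] at this
  linarith

theorem image_theta_Ioi (h₀ : 0 < t₀) (h : deriv theta t₀ = 0) :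
    theta '' Set.Ioi t₀ = Set.Ioi (theta t₀) := by
  ext x
  constructor
  · rintro ⟨t, ht, rfl⟩
    exact theta_strictMonoOn_Ici h₀ h Set.self_mem_Ici (Set.Ioi_subset_Ici_self ht) ht
  · intro hx
    have hx' : theta t₀ < x := hx
    obtain ⟨T, hT, hT'⟩ := ((tendsto_theta_atTop.eventually_ge_atTop x).and
      (Filter.eventually_ge_atTop t₀)).exists
    obtain ⟨t, ht, rfl⟩ := intermediate_value_Icc hT'
      differentiable_theta.continuous.continuousOn ⟨hx'.le, hT⟩
    exact ⟨t, lt_of_le_of_ne ht.1 (by rintro rfl; exact lt_irrefl _ hx'), rfl⟩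

theorem image_theta_Iio (h₀ : 0 < t₀) (h : deriv theta t₀ = 0) :
    theta '' Set.Iio (-t₀) = Set.Iio (-theta t₀) := by
  have h1 := image_theta_Ioi h₀ h
  ext x
  have h2 : -x ∈ theta '' Set.Ioi t₀ ↔ x ∈ Set.Iio (-theta t₀) := by
    rw [h1, Set.mem_Ioi, Set.mem_Iio, lt_neg]
  rw [← h2]
  constructor
  · rintro ⟨t, ht, rfl⟩
    exact ⟨-t, Set.mem_Ioi.2 (lt_neg_of_lt_neg ht), theta_neg t⟩
  · rintro ⟨t, ht, htx⟩
    exact ⟨-t, Set.mem_Iio.2 (neg_lt_neg ht), by rw [theta_neg, htx, neg_neg]⟩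

theorem image_theta_Ioo (h₀ : 0 < t₀) (h : deriv theta t₀ = 0) :
    theta '' Set.Ioo (-t₀) t₀ = Set.Ioo (theta t₀) (-theta t₀) := by
  have ha := theta_strictAntiOn_Icc h₀ h
  have hle : -t₀ ≤ t₀ := by linarith
  apply Set.Subset.antisymm
  · rintro _ ⟨t, ht, rfl⟩
    have ht' := Set.Ioo_subset_Icc_self ht
    refine ⟨ha ht' (Set.right_mem_Icc.2 hle) ht.2, ?_⟩
    rw [← theta_neg]
    exact ha (Set.left_mem_Icc.2 hle) ht' ht.1
  · rw [← theta_neg]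
    exact intermediate_value_Ioo' hle differentiable_theta.continuous.continuousOn

theorem image_thetaInterval (h₀ : 0 < t₀) (h : deriv theta t₀ = 0) (i : Fin 3) :
    theta '' thetaInterval t₀ i = ![Set.Iio (-theta t₀), Set.Ioo (theta t₀) (-theta t₀),
      Set.Ioi (theta t₀)] i := by
  fin_cases i
  · exact image_theta_Iio h₀ h
  · exact image_theta_Ioo h₀ h
  · exact image_theta_Ioi h₀ h

theorem eq_of_translate_eq {m K : ℝ} (hm : 0 < m) (i j : Fin 3)
    (h : ∀ x, x ∈ (![Set.Iio m, Set.Ioo (-m) m, Set.Ioi (-m)] : Fin 3 → Set ℝ) i ↔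
      x + K ∈ (![Set.Iio m, Set.Ioo (-m) m, Set.Ioi (-m)] : Fin 3 → Set ℝ) j) :
    i = j ∧ K = 0 := by
  fin_cases i <;> fin_cases j <;>
    simp [Set.mem_Iio, Set.mem_Ioi, Set.mem_Ioo] at h ⊢
  · have h1 := h m
    have h2 := h (m - K)
    grind
  · have h1 := h (min (m - 1) (-m - K - 1))
    grind
  · have h1 := h (min (m - 1) (-m - K - 1))
    grind
  · have h1 := h (min (-m) (m - K - 1))
    grind
  · have h1 := h (-m)
    have h2 := h m
    have h3 := h 0
    have h4 := h (-K)
    grind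
  · have h1 := h (max m (-m - K + 1))
    grind
  · have h1 := h (max (-m + 1) (m - K))
    grind
  · have h1 := h (max (-m + 1) (m - K))
    grind
  · have h1 := h (-m)
    have h2 := h (-m - K)
    grind

theorem exists_critical_of_mem_closure_image (h₀ : 0 < t₀) (h : deriv theta t₀ = 0) (i : Fin 3)
    {e : ℝ} (he : e ∈ closure (theta '' thetaInterval t₀ i))
    (he' : e ∉ theta '' thetaInterval t₀ i) :
    ∃ c ∈ closure (thetaInterval t₀ i), theta c = e ∧ (c = t₀ ∨ c = -t₀) := by
  have hm := theta_lt_zero h₀ h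
  rw [image_thetaInterval h₀ h] at he he'
  fin_cases i <;> simp [thetaInterval] at he he' ⊢
  · refine ⟨-t₀, le_rfl, ?_, Or.inr rfl⟩
    rw [theta_neg]; linarith
  · rw [closure_Ioo (by linarith)] at he ⊢
    rcases eq_or_lt_of_le he.1 with h1 | h1
    · exact ⟨t₀, Set.right_mem_Icc.2 (by linarith), h1, Or.inl rfl⟩
    · refine ⟨-t₀, Set.left_mem_Icc.2 (by linarith), ?_, Or.inr rfl⟩
      rw [theta_neg]
      exact le_antisymm (he' h1) he.2
  · exact ⟨t₀, le_rfl, by linarith, Or.inl rfl⟩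

end Critical

theorem half_add_mul_I_ne_one (t : ℝ) : (1 / 2 + t * I : ℂ) ≠ 1 := by
  intro h
  have := congrArg re h
  norm_num at this

theorem hasDerivAt_riemannZeta_half_add (t : ℝ) :
    HasDerivAt (fun t : ℝ => riemannZeta (1 / 2 + t * I))
      (deriv riemannZeta (1 / 2 + t * I) * I) t := by
  have h1 := (differentiableAt_riemannZeta (half_add_mul_I_ne_one t)).hasDerivAt
  have h2 : HasDerivAt (fun t : ℝ => (1 / 2 + t * I : ℂ)) I t := by
    simpa using ((ofRealCLM.hasDerivAt (x := t)).mul_const I).const_add (1 / 2)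
  exact h1.comp t h2

theorem analyticAt_riemannZeta_half_add (t : ℝ) :
    AnalyticAt ℝ (fun t : ℝ => riemannZeta (1 / 2 + t * I)) t := by
  have h1 : AnalyticAt ℂ riemannZeta (1 / 2 + t * I) := by
    refine DifferentiableOn.analyticAt (s := {1}ᶜ) (fun s hs =>
      (differentiableAt_riemannZeta hs).differentiableWithinAt)
      (isOpen_compl_singleton.mem_nhds (half_add_mul_I_ne_one t))
  exact AnalyticAt.comp (f := fun t : ℝ => (1 / 2 + t * I : ℂ)) h1.restrictScalars
    (analyticAt_const.add ((ofRealCLM.analyticAt t).mul analyticAt_const))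

theorem riemannZeta_half_add_neg (t : ℝ) :
    riemannZeta (1 / 2 + (-t : ℝ) * I) = (starRingEnd ℂ) (riemannZeta (1 / 2 + t * I)) := by
  rw [← riemannZeta_conj, conj_half_add]
  congr 1
  push_cast
  ring

theorem deriv_riemannZeta_half_add_ne_zero {t : ℝ} (h5 : 5 ≤ |t|) (h7 : |t| ≤ 7) :
    deriv (fun t : ℝ => riemannZeta (1 / 2 + t * I)) t ≠ 0 := by
  have key : ∀ t : ℝ, 5 ≤ t → t ≤ 7 →
      deriv (fun t : ℝ => riemannZeta (1 / 2 + t * I)) t ≠ 0 := fun t h5 h7 => by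
    rw [(hasDerivAt_riemannZeta_half_add t).deriv]
    exact mul_ne_zero (deriv_riemannZeta_ne_zero h5 h7) I_ne_zero
  rcases abs_choice t with e | e
  · rw [e] at h5 h7
    exact key t h5 h7
  · rw [e] at h5 h7
    intro h0
    refine key (-t) h5 h7 ?_
    have h1 : HasDerivAt (fun t : ℝ => riemannZeta (1 / 2 + t * I)) 0 (- -t) := by
      rw [neg_neg, ← h0]
      exact (hasDerivAt_riemannZeta_half_add t).differentiableAt.hasDerivAt
    have h2 := (h1.scomp (-t) (hasDerivAt_neg (-t))).star
    have h3 : (fun x : ℝ => star (((fun t : ℝ => riemannZeta (1 / 2 + t * I)) ∘ Neg.neg) x)) =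
        fun t : ℝ => riemannZeta (1 / 2 + t * I) := by
      ext x
      simp only [Function.comp_apply]
      rw [riemannZeta_half_add_neg]
      exact star_star _
    rw [h3] at h2
    simpa using h2.deriv

theorem zeta_fiber_unique_outside_countable :
    Set.Countable {z : ℂ | ∃ t₁ t₂ : ℝ, t₁ ≠ t₂ ∧
      riemannZeta (1/2 + t₁ * I) = z ∧ riemannZeta (1/2 + t₂ * I) = z} := by
  obtain ⟨t₀, h5, h7, h⟩ := exists_deriv_theta_eq_zero
  have h₀ : 0 < t₀ := by linarith
  have hm := theta_lt_zero h₀ h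
  refine countable_self_intersections_of_phase (I := thetaInterval t₀) (C := {t₀, -t₀})
    analyticAt_riemannZeta_half_add analyticAt_theta ?_ ?_ ?_ ?_ ?_ (Set.toFinite _).countable
    ?_ ?_ ?_ fun a b hab h0 => exists_theta_eq_add_int_mul_pi hab h0
  · intro i
    fin_cases i
    exacts [isOpen_Iio, isOpen_Ioo, isOpen_Ioi]
  · intro i
    fin_cases i
    exacts [isPreconnected_Iio, isPreconnected_Ioo, isPreconnected_Ioi]
  · intro i
    fin_cases i
    · exact ⟨-t₀ - 1, Set.mem_Iio.2 (by linarith), -t₀ - 2, Set.mem_Iio.2 (by linarith),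
        by simp⟩
    · exact ⟨0, Set.mem_Ioo.2 ⟨by linarith, h₀⟩, t₀ / 2,
        Set.mem_Ioo.2 ⟨by linarith, by linarith⟩, by positivity⟩
    · exact ⟨t₀ + 1, Set.mem_Ioi.2 (by linarith), t₀ + 2, Set.mem_Ioi.2 (by linarith),
        by simp⟩
  · intro i
    fin_cases i
    exacts [((theta_strictMonoOn_Iic h₀ h).mono Set.Iio_subset_Iic_self).injOn,
      ((theta_strictAntiOn_Icc h₀ h).mono Set.Ioo_subset_Icc_self).injOn,
      ((theta_strictMonoOn_Ici h₀ h).mono Set.Ioi_subset_Ici_self).injOn]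
  · intro i t ht
    fin_cases i
    · exact (deriv_theta_pos_of_lt_abs h₀ h
        (lt_of_lt_of_le (lt_neg_of_lt_neg ht) (neg_le_abs t))).ne'
    · exact (deriv_theta_neg_of_abs_lt h₀ h (abs_lt.2 ht)).ne
    · exact (deriv_theta_pos_of_lt_abs h₀ h (lt_of_lt_of_le ht (le_abs_self t))).ne'
  · intro t ht
    simp only [Set.mem_insert_iff, Set.mem_singleton_iff, not_or] at ht
    rcases lt_or_gt_of_ne ht.2 with h1 | h1
    · exact ⟨0, h1⟩
    · rcases lt_or_gt_of_ne ht.1 with h2 | h2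
      · exact ⟨1, h1, h2⟩
      · exact ⟨2, h2⟩
  · intro i e he he'
    obtain ⟨c, hc, hce, hct⟩ := exists_critical_of_mem_closure_image h₀ h i he he'
    have habs : |c| = t₀ := by
      rcases hct with rfl | rfl
      · exact abs_of_pos h₀
      · rw [abs_neg, abs_of_pos h₀]
    refine ⟨c, hc, hce, ?_, deriv_riemannZeta_half_add_ne_zero (by rw [habs]; exact h5)
      (by rw [habs]; exact h7)⟩
    rcases hct with rfl | rfl
    · exact h
    · rw [deriv_theta_neg, h]
  · intro i j k hk
    simp only [image_thetaInterval h₀ h] at hk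
    have := eq_of_translate_eq (m := -theta t₀) (K := k * Real.pi) (by linarith) i j
      (by simpa only [neg_neg] using hk)
    refine ⟨this.1, ?_⟩
    have h1 := (mul_eq_zero.1 this.2).resolve_right Real.pi_ne_zero
    exact_mod_cast h1
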